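/- arXiv:1809.04316 — 6 statements merged into one kernel-verified Lean document; each statement's English description precedes it below -/
import Mathlib

section
/- Let R ⊆ S be an extension of unital rings, with R commutative and S finitely generated as an R-module. Let L be the total quotient ring of R. Suppose the natural map S → S ⊗_R L is injective and S ∩ L = R inside S ⊗_R L. If c ⊂ L is an R-submodule with cS = λS for some λ ∈ L^×, then c = λR. -/
/-!
STATEMENT 1: Let `R ⊆ S` be an extension of unital rings, with `R` commutative and `S`
finitely generated as an `R`-module.  Let `L` be the total quotient ring of `R`
(the localization of `R` at its nonzerodivisors, `FractionRing R` in Mathlib).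
Suppose the natural map `S → S ⊗[R] L` is injective and `S ∩ L = R` inside `S ⊗[R] L`.
If `c ⊆ L` is an `R`-submodule with `cS = λS` for some unit `λ ∈ Lˣ`, then `c = λR`.

Here `S` and `L` are viewed inside `S ⊗[R] L` via `includeLeft` and `includeRight`;
`cS` denotes the (left) `S`-submodule of `S ⊗[R] L` generated by the image of `c`,
and `λS` the `S`-submodule generated by `includeRight λ`; `λR = span R {λ} ⊆ L`.
-/

open scoped TensorProduct

theorem submodule_eq_span_unit_of_smul_eq {R S : Type*} [CommRing R] [Ring S] [Algebra R S]
    (h_ext : Function.Injective (algebraMap R S)) [Module.Finite R S]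
    (h_inj : Function.Injective
      (Algebra.TensorProduct.includeLeft : S →ₐ[R] S ⊗[R] FractionRing R))
    (h_cap : (Algebra.TensorProduct.includeLeft : S →ₐ[R] S ⊗[R] FractionRing R).range ⊓
        (Algebra.TensorProduct.includeRight : FractionRing R →ₐ[R] S ⊗[R] FractionRing R).range
        = ⊥)
    (c : Submodule R (FractionRing R)) (lam : (FractionRing R)ˣ)
    (h : Submodule.span S
          ((Algebra.TensorProduct.includeRight :
              FractionRing R →ₐ[R] S ⊗[R] FractionRing R) '' (c : Set (FractionRing R)))
        = Submodule.span S
            {(Algebra.TensorProduct.includeRight :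
                FractionRing R →ₐ[R] S ⊗[R] FractionRing R) (lam : FractionRing R)}) :
    c = Submodule.span R {(lam : FractionRing R)} := by
  have right_inj : Function.Injective (Algebra.TensorProduct.includeRight :
      FractionRing R →ₐ[R] S ⊗[R] FractionRing R) :=
    Algebra.TensorProduct.includeRight_injective h_ext
  set ι : FractionRing R →ₐ[R] S ⊗[R] FractionRing R := Algebra.TensorProduct.includeRight
    with hι
  set j : S →ₐ[R] S ⊗[R] FractionRing R := Algebra.TensorProduct.includeLeft with hj
  have smul_eq (s : S) (z : S ⊗[R] FractionRing R) : s • z = j s * z := by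
    induction z with
    | zero => simp
    | add x y hx hy => simp only [smul_add, mul_add, hx, hy]
    | tmul t l => simp [hj, TensorProduct.smul_tmul']
  have lam_mul_inv : ι lam * ι ↑lam⁻¹ = 1 := by
    rw [← map_mul, Units.mul_inv, map_one]
  have exists_smul {x : FractionRing R} (hx : x ∈ c) : ∃ r : R, r • (lam : FractionRing R) = x := by
    have hxs : ι x ∈ Submodule.span S {ι lam} := h ▸ Submodule.subset_span ⟨x, hx, rfl⟩
    obtain ⟨s, hs⟩ := Submodule.mem_span_singleton.mp hxs
    have hs' : j s = ι (x * ↑lam⁻¹) := by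
      rw [map_mul, ← hs, smul_eq, mul_assoc, lam_mul_inv, mul_one]
    have hmem : ι (x * ↑lam⁻¹) ∈ j.range ⊓ ι.range := ⟨⟨s, hs'⟩, ⟨_, rfl⟩⟩
    rw [h_cap, Algebra.mem_bot] at hmem
    obtain ⟨r, hr⟩ := hmem
    refine ⟨r, ?_⟩
    rw [← ι.commutes] at hr
    rw [Algebra.smul_def, right_inj hr, Units.inv_mul_cancel_right]
  let I : Ideal R := c.comap (LinearMap.toSpanSingleton R (FractionRing R) lam)
  have mul_mem (s : S) {t : S} (ht : t ∈ I • (⊤ : Submodule R S)) :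
      s * t ∈ I • (⊤ : Submodule R S) := by
    refine Submodule.smul_induction_on ht (fun r hr n _ => ?_) fun x y hx hy => ?_
    · rw [mul_smul_comm]
      exact Submodule.smul_mem_smul hr Submodule.mem_top
    · rw [mul_add]
      exact add_mem hx hy
  have exists_preimage {z : S ⊗[R] FractionRing R} (hz : z ∈ Submodule.span S (ι '' c)) :
      ∃ t ∈ I • (⊤ : Submodule R S), j t = z * ι ↑lam⁻¹ := by
    induction hz using Submodule.span_induction with
    | mem z hz =>
      obtain ⟨x, hx, rfl⟩ := hz
      obtain ⟨r, rfl⟩ := exists_smul hx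
      refine ⟨r • 1, Submodule.smul_mem_smul hx Submodule.mem_top, ?_⟩
      rw [map_smul, map_one, map_smul, smul_mul_assoc, lam_mul_inv]
    | zero => exact ⟨0, zero_mem _, by simp⟩
    | add x y _ _ hx hy =>
      obtain ⟨t, ht, htx⟩ := hx
      obtain ⟨u, hu, huy⟩ := hy
      exact ⟨t + u, add_mem ht hu, by rw [map_add, add_mul, htx, huy]⟩
    | smul s z _ hz =>
      obtain ⟨t, ht, htz⟩ := hz
      exact ⟨s * t, mul_mem s ht, by rw [map_mul, htz, smul_eq, mul_assoc]⟩
  obtain ⟨t, ht, htlam⟩ := exists_preimage (h ▸ Submodule.mem_span_singleton_self (ι lam))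
  rw [lam_mul_inv, ← map_one j] at htlam
  have one_mem : (1 : S) ∈ I • (⊤ : Submodule R S) := h_inj htlam ▸ ht
  obtain ⟨r, hr, hr0⟩ := Submodule.exists_sub_one_mem_and_smul_eq_zero_of_fg_of_le_smul I
    (⊤ : Submodule R S) Module.Finite.fg_top fun s _ => by simpa using mul_mem s one_mem
  have r_eq : r = 0 := h_ext (by
    rw [map_zero, Algebra.algebraMap_eq_smul_one, hr0 1 Submodule.mem_top])
  have lam_mem : (lam : FractionRing R) ∈ c := by
    simpa [I, r_eq] using hr
  refine le_antisymm (fun x hx => Submodule.mem_span_singleton.mpr (exists_smul hx)) ?_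
  rwa [Submodule.span_singleton_le_iff_mem]
end

section
/- Let F be a number field, A a ℤ-order in F, and O a proper A-order in a quaternion F-algebra D. Suppose a ⊂ F is a locally principal nonzero fractional A-ideal with aO = λO for some λ ∈ D with λ ∉ F. Then aB = λB, where B := F[λ] ∩ O. In particular, the class [a] lies in the kernel of the canonical map Pic(A) → Pic(B), [b] ↦ [bB]. -/
/-!
STATEMENT 3: Let `F` be a number field, `A` a `ℤ`-order in `F`, and `O` a proper `A`-order
in a quaternion `F`-algebra `D = ℍ[F,c₁,c₂]`.  Suppose `a ⊆ F` is a locally principal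
nonzero fractional `A`-ideal with `aO = λO` for some `λ ∈ D` with `λ ∉ F`.  Then
`aB = λB` where `B := F[λ] ∩ O`.  In particular the class `[a]` lies in the kernel of the
canonical map `Pic(A) → Pic(B)`, `[b] ↦ [bB]`, i.e. the extended ideal `aB` is a principal
`B`-ideal generated by an invertible element of `F[λ]`.

Conventions: locally principal nonzero fractional `A`-ideal = invertible `A`-submodule of
`F`; `F[λ] = Algebra.adjoin F {λ}`; `aB` is the `ℤ`-submodule of `D` generated by the
products `f·y` with `f ∈ a`, `y ∈ B`; `λB` is the image of `B` under left multiplication.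
-/

open scoped Quaternion

/-- A `ℤ`-order in a `ℚ`-algebra `V`. -/
def IsZOrder {V : Type*} [Ring V] [Algebra ℚ V] (O : Subalgebra ℤ V) : Prop :=
  (Subalgebra.toSubmodule O).FG ∧ Submodule.span ℚ (O : Set V) = ⊤

/-- `O` is a proper `A`-order in `D = ℍ[F,c₁,c₂]`. -/
def IsProperOrder {F : Type*} [Field F] [NumberField F] {c₁ c₂ : F}
    (A : Subalgebra ℤ F) (O : Subalgebra ℤ ℍ[F, c₁, c₂]) : Prop :=
  IsZOrder O ∧ ∀ x : F, algebraMap F ℍ[F, c₁, c₂] x ∈ O ↔ x ∈ A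

/-- In a finite-dimensional algebra, an element with a right inverse has a two-sided inverse
which is a polynomial in that element. -/
theorem exists_mem_adjoin_inverse_of_mul_eq_one {F D : Type*} [Field F] [Ring D] [Algebra F D]
    [FiniteDimensional F D] {x r : D} (hr : x * r = 1) :
    ∃ g ∈ Algebra.adjoin F {x}, x * g = 1 ∧ g * x = 1 := by
  have hsurj : Function.Surjective (LinearMap.mulLeft F x) := fun z =>
    ⟨r * z, by simp [← mul_assoc, hr]⟩
  have hinj : Function.Injective (LinearMap.mulLeft F x) :=
    LinearMap.injective_iff_surjective.mpr hsurj
  let s : Algebra.adjoin F {x} := ⟨x, Algebra.self_mem_adjoin_singleton F x⟩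
  have hinj' : Function.Injective (LinearMap.mulLeft F s) := by
    intro u v huv
    exact Subtype.ext (hinj (congrArg Subtype.val huv))
  obtain ⟨g, hg⟩ := LinearMap.injective_iff_surjective.mp hinj' 1
  have hxg : x * (g : D) = 1 := congrArg Subtype.val hg
  refine ⟨g, g.2, hxg, hinj ?_⟩
  simp [← mul_assoc, hxg]

/-- If `a * b = 1` and `z ∈ aO`, then `bz ⊆ O`, provided `A ⊆ O`. -/
theorem algebraMap_mul_mem_of_mem_span {F D : Type*} [Field F] [Ring D] [Algebra F D]
    {A : Subalgebra ℤ F} {O : Subalgebra ℤ D} (hAO : ∀ x ∈ A, algebraMap F D x ∈ O)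
    {a b : Submodule ↥A F} (hab : a * b = 1) {z : D}
    (hz : z ∈ Submodule.span ℤ {z : D | ∃ f ∈ a, ∃ y ∈ O, z = algebraMap F D f * y})
    {g : F} (hg : g ∈ b) : algebraMap F D g * z ∈ O := by
  induction hz using Submodule.span_induction with
  | mem z hz =>
    obtain ⟨f, hf, y, hy, rfl⟩ := hz
    rw [← mul_assoc, ← map_mul, mul_comm g f]
    refine O.mul_mem (hAO _ ?_) hy
    have hfg := Submodule.mul_mem_mul hf hg
    rw [hab] at hfg
    obtain ⟨c, hc⟩ := Submodule.mem_one.mp hfg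
    exact hc ▸ c.2
  | zero => simp
  | add u v _ _ hu hv => rw [mul_add]; exact O.add_mem hu hv
  | smul n u _ hu => rw [mul_smul_comm]; exact O.smul_mem hu n

/-- If `a * b = 1` and `bz ⊆ B`, then `z ∈ aB`. -/
theorem mem_span_of_algebraMap_mul_mem {F D : Type*} [Field F] [Ring D] [Algebra F D]
    {A : Subalgebra ℤ F} {B : Subalgebra ℤ D}
    {a b : Submodule ↥A F} (hab : a * b = 1) {z : D}
    (hz : ∀ g ∈ b, algebraMap F D g * z ∈ B) :
    z ∈ Submodule.span ℤ {z : D | ∃ f ∈ a, ∃ y ∈ B, z = algebraMap F D f * y} := by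
  have key : ∀ t ∈ a * b, algebraMap F D t * z ∈
      Submodule.span ℤ {z : D | ∃ f ∈ a, ∃ y ∈ B, z = algebraMap F D f * y} := by
    intro t ht
    induction ht using Submodule.mul_induction_on' with
    | mem_mul_mem f hf g hg =>
      exact Submodule.subset_span ⟨f, hf, _, hz g hg, by rw [map_mul, mul_assoc]⟩
    | add u _ v _ hu hv => rw [map_add, add_mul]; exact add_mem hu hv
  have h1 : (1 : F) ∈ a * b := hab ▸ Submodule.one_le.mp le_rfl
  simpa using key 1 h1

theorem frac_ideal_capitulates_in_quadratic_order
    {F : Type*} [Field F] [NumberField F] {c₁ c₂ : F}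
    (A : Subalgebra ℤ F) (hA : IsZOrder A)
    (O : Subalgebra ℤ ℍ[F, c₁, c₂]) (hO : IsProperOrder A O)
    (a : Submodule ↥A F) (ha : a ≠ ⊥) (hlp : ∃ b : Submodule ↥A F, a * b = 1)
    (lam : ℍ[F, c₁, c₂]) (hlam : lam ∉ Set.range (algebraMap F ℍ[F, c₁, c₂]))
    (h : Submodule.span ℤ {z : ℍ[F, c₁, c₂] | ∃ f ∈ a, ∃ y ∈ O, z = algebraMap F _ f * y}
        = (Subalgebra.toSubmodule O).map (LinearMap.mulLeft ℤ lam)) :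
    -- `B = F[λ] ∩ O`
    (Submodule.span ℤ {z : ℍ[F, c₁, c₂] | ∃ f ∈ a,
        ∃ y ∈ (Algebra.adjoin F {lam}).restrictScalars ℤ ⊓ O, z = algebraMap F _ f * y}
      = (Subalgebra.toSubmodule ((Algebra.adjoin F {lam}).restrictScalars ℤ ⊓ O)).map
          (LinearMap.mulLeft ℤ lam)) ∧
    -- `[a] ∈ ker (Pic(A) → Pic(B))`: the extension `aB` is principal, generated by an
    -- invertible element of `F[λ]`.
    (∃ μ : ℍ[F, c₁, c₂], μ ∈ Algebra.adjoin F {lam} ∧ IsUnit μ ∧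
      Submodule.span ℤ {z : ℍ[F, c₁, c₂] | ∃ f ∈ a,
          ∃ y ∈ (Algebra.adjoin F {lam}).restrictScalars ℤ ⊓ O, z = algebraMap F _ f * y}
        = (Subalgebra.toSubmodule ((Algebra.adjoin F {lam}).restrictScalars ℤ ⊓ O)).map
            (LinearMap.mulLeft ℤ μ)) := by
  obtain ⟨b, hab⟩ := hlp
  obtain ⟨f₀, hf₀, hf₀0⟩ := Submodule.exists_mem_ne_zero_of_ne_bot ha
  obtain ⟨r, hr⟩ : ∃ r, lam * r = 1 := by
    have hmem : algebraMap F ℍ[F, c₁, c₂] f₀ ∈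
        (Subalgebra.toSubmodule O).map (LinearMap.mulLeft ℤ lam) :=
      h ▸ Submodule.subset_span ⟨f₀, hf₀, 1, O.one_mem, (mul_one _).symm⟩
    obtain ⟨y, -, hy⟩ := hmem
    have hy' : lam * y = algebraMap F ℍ[F, c₁, c₂] f₀ := hy
    refine ⟨y * algebraMap F _ f₀⁻¹, ?_⟩
    rw [← mul_assoc, hy', ← map_mul, mul_inv_cancel₀ hf₀0, map_one]
  obtain ⟨g, hg, hlg, hgl⟩ := exists_mem_adjoin_inverse_of_mul_eq_one (F := F) hr
  have hlam_mem := Algebra.self_mem_adjoin_singleton F lam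
  have main : Submodule.span ℤ {z : ℍ[F, c₁, c₂] | ∃ f ∈ a,
        ∃ y ∈ (Algebra.adjoin F {lam}).restrictScalars ℤ ⊓ O, z = algebraMap F _ f * y}
      = (Subalgebra.toSubmodule ((Algebra.adjoin F {lam}).restrictScalars ℤ ⊓ O)).map
          (LinearMap.mulLeft ℤ lam) := by
    apply le_antisymm
    · rw [Submodule.span_le]
      rintro _ ⟨f, hf, y, ⟨hyF, hyO⟩, rfl⟩
      have hmem : algebraMap F ℍ[F, c₁, c₂] f * y ∈
          (Subalgebra.toSubmodule O).map (LinearMap.mulLeft ℤ lam) :=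
        h ▸ Submodule.subset_span ⟨f, hf, y, hyO, rfl⟩
      obtain ⟨w, hwO, hw⟩ := hmem
      have hw' : lam * w = algebraMap F ℍ[F, c₁, c₂] f * y := hw
      refine ⟨w, ⟨?_, hwO⟩, hw⟩
      have hwg : w = g * (algebraMap F _ f * y) := by rw [← hw', ← mul_assoc, hgl, one_mul]
      rw [hwg]
      exact mul_mem hg (mul_mem (Subalgebra.algebraMap_mem _ f) hyF)
    · rintro _ ⟨y, ⟨hyF, hyO⟩, rfl⟩
      refine mem_span_of_algebraMap_mul_mem hab fun t ht => ⟨?_, ?_⟩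
      · exact mul_mem (Subalgebra.algebraMap_mem _ t) (mul_mem hlam_mem hyF)
      · refine algebraMap_mul_mem_of_mem_span (fun x hx => (hO.2 x).mpr hx) hab ?_ ht
        rw [h]
        exact ⟨y, hyO, rfl⟩
  exact ⟨main, lam, hlam_mem, ⟨⟨lam, g, hlg, hgl⟩, rfl⟩, main⟩
end

section
/- Let F be a totally real number field and A a ℤ-order in F. Then the set 𝓑 of A-isomorphism classes of CM proper A-orders B with nontrivial kernel ker(i_{B/A}: Pic(A) → Pic(B)) is finite. -/
/-!
STATEMENT 7: Let `F` be a totally real number field and `A` a `ℤ`-order in `F`.  Then the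
set `𝓑` of `A`-isomorphism classes of CM proper `A`-orders `B` with nontrivial kernel
`ker (i_{B/A} : Pic(A) → Pic(B))` is finite.

CM proper `A`-orders are realized inside a fixed algebraic closure of `F` (every CM
extension of `F` embeds there), and `A`-isomorphism is implemented by `F`-automorphisms of
the algebraic closure.  Nontriviality of `ker (i_{B/A})` means that some non-principal
invertible (= locally principal) fractional `A`-ideal capitulates (becomes principal)
in `B`.
-/

noncomputable section
set_option synthInstance.maxHeartbeats 1000000
set_option maxHeartbeats 1000000

section PicardConstruction

open scoped Pointwise

variable {L : Type*} [CommRing L]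

instance unitsCommGroup (A : Subalgebra ℤ L) : CommGroup (Submodule ↥A L)ˣ :=
  Units.instCommGroupUnits (α := Submodule ↥A L)

/-- The subgroup of principal invertible fractional ideals (those generated by a single
invertible element of `L`). -/
def principalSub (A : Subalgebra ℤ L) : Subgroup (Submodule ↥A L)ˣ where
  carrier := {u | ∃ x : L, IsUnit x ∧ (u : Submodule ↥A L) = Submodule.span ↥A {x}}
  one_mem' := ⟨1, isUnit_one, by simp [Submodule.one_eq_span]⟩
  mul_mem' := by
    rintro u v ⟨x, hx, hux⟩ ⟨y, hy, hvy⟩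
    exact ⟨x * y, hx.mul hy, by
      push_cast [hux, hvy]
      rw [Submodule.span_mul_span, Set.singleton_mul_singleton]⟩
  inv_mem' := by
    rintro u ⟨x, hx, hux⟩
    refine ⟨(hx.unit⁻¹ : Lˣ), Units.isUnit _, ?_⟩
    have h1 : (u : Submodule ↥A L) * Submodule.span ↥A {((hx.unit⁻¹ : Lˣ) : L)} = 1 := by
      rw [hux, Submodule.span_mul_span, Set.singleton_mul_singleton]
      simp [Submodule.one_eq_span]
    calc ((u⁻¹ : (Submodule ↥A L)ˣ) : Submodule ↥A L)
        = (u⁻¹ : (Submodule ↥A L)ˣ) * ((u : Submodule ↥A L) *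
            Submodule.span ↥A {((hx.unit⁻¹ : Lˣ) : L)}) := by
            rw [h1]; exact (mul_one ((u⁻¹ : (Submodule ↥A L)ˣ) : Submodule ↥A L)).symm
      _ = Submodule.span ↥A {((hx.unit⁻¹ : Lˣ) : L)} := by
            rw [← mul_assoc, ← Units.val_mul, inv_mul_cancel, Units.val_one]
            exact one_mul (Submodule.span ↥A {((hx.unit⁻¹ : Lˣ) : L)})

/-- The Picard group of a `ℤ`-order `A` realized inside `L`: invertible (equivalently,
locally principal) fractional `A`-ideals modulo principal fractional `A`-ideals. -/
def Picard (A : Subalgebra ℤ L) : Type _ := (Submodule ↥A L)ˣ ⧸ principalSub A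

noncomputable instance (A : Subalgebra ℤ L) : CommGroup (Picard A) :=
  QuotientGroup.Quotient.commGroup (principalSub A)

/-- The ideal class of an invertible fractional ideal in the Picard group. -/
def picCls (A : Subalgebra ℤ L) (u : (Submodule ↥A L)ˣ) : Picard A := QuotientGroup.mk u

/-- The class number `h(A) = |Pic(A)|` of a `ℤ`-order `A` realized in `L`. -/
noncomputable def hPic (A : Subalgebra ℤ L) : ℕ := Nat.card (Picard A)

end PicardConstruction
section CMOrders

open scoped Pointwise

variable {F : Type*} [Field F] [NumberField F]

/-- `F` is totally real: every complex embedding of `F` is real. -/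
def TotReal (F : Type*) [Field F] [NumberField F] : Prop :=
  ∀ φ : F →+* ℂ, NumberField.ComplexEmbedding.IsReal φ

/-- An element of `F` is totally positive. -/
def TotPos {F : Type*} [Field F] (x : F) : Prop := ∀ σ : F →+* ℝ, 0 < σ x

/-- A fractional ideal is principal (generated by a single nonzero element). -/
def IsPrincipalIdl (A : Subalgebra ℤ F) (a : Submodule ↥A F) : Prop :=
  ∃ x : F, x ≠ 0 ∧ a = Submodule.span ↥A {x}

/-- A CM proper `A`-order, realized inside a fixed algebraic closure `Ω` of `F`:
a `ℤ`-order `B` of full rank in a totally imaginary quadratic extension `K ⊆ Ω` of `F`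
with `B ∩ F = A`.  Here `K = F[B]` is the `F`-subalgebra generated by `B`. -/
structure CMOrder (A : Subalgebra ℤ F) where
  B : Subalgebra ℤ (AlgebraicClosure F)
  fg : (Subalgebra.toSubmodule B).FG
  quadratic : Module.finrank F ↥(Algebra.adjoin F (B : Set (AlgebraicClosure F))) = 2
  imaginary : IsEmpty (↥(Algebra.adjoin F (B : Set (AlgebraicClosure F))) →+* ℝ)
  full : Submodule.span ℚ (B : Set (AlgebraicClosure F))
      = Subalgebra.toSubmodule
          ((Algebra.adjoin F (B : Set (AlgebraicClosure F))).restrictScalars ℚ)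
  proper : ∀ x : F, algebraMap F (AlgebraicClosure F) x ∈ B ↔ x ∈ A

/-- The extension `aB` of a fractional `A`-ideal `a ⊆ F` to a `ℤ`-order `B ⊆ Ω`. -/
def extIdeal {A : Subalgebra ℤ F} (B : Subalgebra ℤ (AlgebraicClosure F))
    (a : Submodule ↥A F) : Submodule ↥B (AlgebraicClosure F) :=
  Submodule.span ↥B (algebraMap F (AlgebraicClosure F) '' (a : Set F))

/-- The fractional `A`-ideal `a` capitulates in `B`: the extended ideal `aB` is
principal. -/
def Capitulates {A : Subalgebra ℤ F} (B : Subalgebra ℤ (AlgebraicClosure F))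
    (a : Submodule ↥A F) : Prop :=
  ∃ x : AlgebraicClosure F, x ≠ 0 ∧ extIdeal B a = Submodule.span ↥B {x}

/-- The kernel of `i_{B/A} : Pic(A) → Pic(B)` is nontrivial: some non-principal invertible
fractional `A`-ideal capitulates in `B`. -/
def HasNontrivialKernel {A : Subalgebra ℤ F} (C : CMOrder A) : Prop :=
  ∃ u : (Submodule ↥A F)ˣ, ¬ IsPrincipalIdl A (u : Submodule ↥A F) ∧
    Capitulates C.B (u : Submodule ↥A F)

/-- `A`-isomorphism of CM proper `A`-orders: an `F`-algebra isomorphism of their fraction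
fields carrying one order onto the other (equivalently, an `F`-automorphism of the ambient
algebraic closure doing so). -/
def CMIso {A : Subalgebra ℤ F} (C C' : CMOrder A) : Prop :=
  ∃ σ : AlgebraicClosure F ≃ₐ[F] AlgebraicClosure F,
    C.B.map (σ.toAlgHom.restrictScalars ℤ) = C'.B

/-- `B` is stable under the nontrivial automorphism of `K/F` (i.e. `B = B̄`):
every `F`-automorphism of `Ω` preserving `K = F[B]` maps `B` onto `B`. -/
def ConjStable {A : Subalgebra ℤ F} (C : CMOrder A) : Prop :=
  ∀ σ : AlgebraicClosure F ≃ₐ[F] AlgebraicClosure F,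
    (∀ x ∈ Algebra.adjoin F (C.B : Set (AlgebraicClosure F)),
      σ x ∈ Algebra.adjoin F (C.B : Set (AlgebraicClosure F))) →
    C.B.map (σ.toAlgHom.restrictScalars ℤ) = C.B

open Classical in
/-- `δ(B) = 1` if `B = B̄`, and `δ(B) = 0` otherwise. -/
noncomputable def deltaB {A : Subalgebra ℤ F} (C : CMOrder A) : ℚ :=
  if ConjStable C then 1 else 0

end CMOrders

theorem finite_setOf_submodule_between {V : Type*} [AddCommGroup V] {J : Submodule ℤ V}
    (hJ : J.FG) {m : ℤ} (hm : m ≠ 0) :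
    {P : Submodule ℤ V | P ≤ J ∧ ∀ v ∈ J, m • v ∈ P}.Finite := by
  let N : Submodule ℤ J := LinearMap.range (m • (LinearMap.id : J →ₗ[ℤ] J))
  have : Module.Finite ℤ J := Module.Finite.iff_fg.mpr hJ
  have htors : Module.IsTorsion ℤ (J ⧸ N) := by
    intro x
    obtain ⟨y, rfl⟩ := N.mkQ_surjective x
    refine ⟨⟨m, mem_nonZeroDivisors_of_ne_zero hm⟩, ?_⟩
    rw [Submonoid.mk_smul, ← map_smul, Submodule.mkQ_apply, Submodule.Quotient.mk_eq_zero]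
    exact ⟨y, rfl⟩
  have : Finite (J ⧸ N) := Module.finite_of_fg_torsion _ htors
  refine Set.Finite.of_finite_image (f := fun P => (P.comap J.subtype).map N.mkQ)
    (Set.toFinite _) ?_
  rintro P ⟨hPJ, hP⟩ Q ⟨hQJ, hQ⟩ hPQ
  have key : ∀ P : Submodule ℤ V, (∀ v ∈ J, m • v ∈ P) →
      ((P.comap J.subtype).map N.mkQ).comap N.mkQ = P.comap J.subtype := by
    intro P hP
    rw [Submodule.comap_map_mkQ, sup_eq_right]
    rintro _ ⟨y, rfl⟩
    exact hP y y.2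
  have h : P.comap J.subtype = Q.comap J.subtype := by
    rw [← key P hP, ← key Q hQ]
    exact congrArg _ hPQ
  rw [← Submodule.map_comap_eq_of_le (f := J.subtype) (p := P) (by simpa using hPJ), h,
    Submodule.map_comap_eq_of_le (by simpa using hQJ)]

theorem exists_zsmul_mem_of_mem_span_rat {V : Type*} [AddCommGroup V] [Module ℚ V]
    (R : Submodule ℤ V) {v : V} (hv : v ∈ Submodule.span ℚ (R : Set V)) :
    ∃ m : ℤ, m ≠ 0 ∧ m • v ∈ R := by
  induction hv using Submodule.span_induction with
  | mem x hx => exact ⟨1, one_ne_zero, by simpa using hx⟩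
  | zero => exact ⟨1, one_ne_zero, by simp⟩
  | add x y _ _ hx hy =>
    obtain ⟨m, hm, hmx⟩ := hx
    obtain ⟨n, hn, hny⟩ := hy
    refine ⟨m * n, mul_ne_zero hm hn, ?_⟩
    rw [smul_add]
    refine add_mem ?_ ?_
    · rw [mul_comm, mul_smul]; exact R.smul_mem _ hmx
    · rw [mul_smul]; exact R.smul_mem _ hny
  | smul q x _ hx =>
    obtain ⟨m, hm, hmx⟩ := hx
    refine ⟨m * q.den, mul_ne_zero hm (by exact_mod_cast q.den_nz), ?_⟩
    have : (m * q.den : ℤ) • q • x = q.num • m • x := by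
      simp only [← Int.cast_smul_eq_zsmul ℚ, smul_smul]
      congr 1
      push_cast
      rw [mul_assoc, Rat.den_mul_eq_num, mul_comm]
    rw [this]
    exact R.smul_mem _ hmx

theorem exists_zsmul_mem_of_le_span_rat {V : Type*} [AddCommGroup V] [Module ℚ V]
    (R : Submodule ℤ V) {J : Submodule ℤ V} (hJ : J.FG)
    (h : ∀ v ∈ J, v ∈ Submodule.span ℚ (R : Set V)) :
    ∃ m : ℤ, m ≠ 0 ∧ ∀ v ∈ J, m • v ∈ R := by
  induction J, hJ using Submodule.fg_induction with
  | singleton x =>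
    obtain ⟨m, hm, hmx⟩ := exists_zsmul_mem_of_mem_span_rat R
      (h x (Submodule.mem_span_singleton_self x))
    refine ⟨m, hm, fun v hv => ?_⟩
    obtain ⟨a, rfl⟩ := Submodule.mem_span_singleton.mp hv
    rw [smul_comm]
    exact R.smul_mem _ hmx
  | sup J₁ J₂ _ _ h₁ h₂ =>
    obtain ⟨m, hm, hm'⟩ := h₁ fun v hv => h v (Submodule.mem_sup_left hv)
    obtain ⟨n, hn, hn'⟩ := h₂ fun v hv => h v (Submodule.mem_sup_right hv)
    refine ⟨m * n, mul_ne_zero hm hn, fun v hv => ?_⟩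
    obtain ⟨x, hx, y, hy, rfl⟩ := Submodule.mem_sup.mp hv
    rw [smul_add]
    refine add_mem ?_ ?_
    · rw [mul_comm, mul_smul]; exact R.smul_mem _ (hm' x hx)
    · rw [mul_smul]; exact R.smul_mem _ (hn' y hy)

theorem dvd_factorial_of_totient_le {k n : ℕ} (hk : k ≠ 0) (h : k.totient ≤ n) :
    k ∣ (2 * n).factorial := by
  rw [Nat.dvd_iff_prime_pow_dvd_dvd]
  intro p e hp hpe
  refine Nat.dvd_factorial (pow_pos hp.pos e) ?_
  have h1 : (p ^ e).totient ≤ n :=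
    (Nat.le_of_dvd (Nat.totient_pos.mpr (Nat.pos_of_ne_zero hk))
      (Nat.totient_dvd_of_dvd hpe)).trans h
  refine le_trans ?_ (Nat.mul_le_mul_left 2 h1)
  rcases Nat.eq_zero_or_pos e with rfl | he
  · simp
  · rw [Nat.totient_prime_pow hp he]
    obtain ⟨d, rfl⟩ : ∃ d, e = d + 1 := ⟨e - 1, by omega⟩
    rw [Nat.add_sub_cancel, pow_succ, mul_left_comm]
    exact Nat.mul_le_mul_left _ (by have := hp.two_le; omega)

theorem pow_factorial_eq_one_of_pow_eq_one {K : Type*} [Field K] [NumberField K] {ζ : K} {k : ℕ}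
    (hk : 0 < k) (hζ : ζ ^ k = 1) : ζ ^ (2 * Module.finrank ℚ K).factorial = 1 := by
  have hfin : IsOfFinOrder ζ := isOfFinOrder_iff_pow_eq_one.mpr ⟨k, hk, hζ⟩
  have hprim : IsPrimitiveRoot ζ (orderOf ζ) := IsPrimitiveRoot.orderOf ζ
  have hint : IsIntegral ℤ ζ := hprim.isIntegral hfin.orderOf_pos
  have hdeg : (orderOf ζ).totient ≤ Module.finrank ℚ K := by
    refine hprim.totient_le_degree_minpoly.trans ?_
    rw [← (minpoly.monic hint).natDegree_map (algebraMap ℤ ℚ),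
      ← minpoly.isIntegrallyClosed_eq_field_fractions' ℚ hint]
    exact minpoly.natDegree_le ζ
  exact orderOf_dvd_iff_pow_eq_one.mp
    (dvd_factorial_of_totient_le hfin.orderOf_pos.ne' hdeg)

theorem pow_factorial_mem_range_of_pow_eq_mul_unit {F K : Type*} [Field F] [NumberField F]
    [Field K] [NumberField K] [Algebra F K] (hF : TotReal F) (hK : Module.finrank F K = 2)
    (hKim : IsEmpty (K →+* ℝ)) {x : K} (hx : x ≠ 0) {h : ℕ} (hh : h ≠ 0) {c : F} {u v : K}
    (hu : IsIntegral ℤ u) (hv : IsIntegral ℤ v) (huv : u * v = 1)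
    (hxu : x ^ h = algebraMap F K c * u) :
    x ^ (2 * Module.finrank ℚ K).factorial ∈ Set.range (algebraMap F K) := by
  have : NumberField.IsTotallyReal F := ⟨fun w => by
    rw [NumberField.InfinitePlace.isReal_iff]; exact hF _⟩
  have : NumberField.IsTotallyComplex K := ⟨fun w => by
    rw [← NumberField.InfinitePlace.not_isReal_iff_isComplex]
    exact fun hw => hKim.false (NumberField.InfinitePlace.embedding_of_isReal hw)⟩
  have : Algebra.IsQuadraticExtension F K := ⟨hK⟩
  have : NumberField.IsCMField K := NumberField.IsCMField.ofCMExtension F K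
  let σ := NumberField.IsCMField.complexConj K
  have hσF : ∀ f : F, σ (algebraMap F K f) = algebraMap F K f := fun f =>
    σ.commutes (NumberField.CMExtension.equivMaximalRealSubfield F K f)
  have hσx : σ x ≠ 0 := by simpa using hx
  have hc : algebraMap F K c ≠ 0 := fun h0 => pow_ne_zero h hx (by rw [hxu, h0, zero_mul])
  have hu0 : u ≠ 0 := left_ne_zero_of_mul_eq_one huv
  have hζh : (σ x / x) ^ h = σ u * v := by
    rw [div_pow, ← map_pow, hxu, map_mul, hσF, mul_div_mul_left _ _ hc, div_eq_mul_inv,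
      eq_inv_of_mul_eq_one_right huv]
  have hint : IsIntegral ℤ (σ x / x) := by
    refine IsIntegral.of_pow (Nat.pos_of_ne_zero hh) ?_
    rw [hζh]
    exact (hu.map (σ.toAlgHom.restrictScalars ℤ)).mul hv
  obtain ⟨k, hk, hζk⟩ := NumberField.Embeddings.pow_eq_one_of_norm_eq_one K ℂ hint fun φ => by
    rw [map_div₀, norm_div, NumberField.IsCMField.complexEmbedding_complexConj, RCLike.norm_conj,
      div_self (by simpa using hx)]
  have h1 := pow_factorial_eq_one_of_pow_eq_one hk hζk
  rw [div_pow, div_eq_one_iff_eq (pow_ne_zero _ hx), ← map_pow,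
    NumberField.IsCMField.complexConj_eq_self_iff] at h1
  exact ⟨(NumberField.CMExtension.equivMaximalRealSubfield F K).symm ⟨_, h1⟩,
    NumberField.CMExtension.algebraMap_equivMaximalRealSubfield_symm_apply F K _⟩

/-- The invertible fractional ideal generated by a unit. -/
def spanUnit {L : Type*} [CommRing L] (A : Subalgebra ℤ L) (c : Lˣ) : (Submodule ↥A L)ˣ where
  val := Submodule.span ↥A {(c : L)}
  inv := Submodule.span ↥A {((c⁻¹ : Lˣ) : L)}
  val_inv := by
    rw [Submodule.span_mul_span, Set.singleton_mul_singleton]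
    simp [Submodule.one_eq_span]
  inv_val := by
    rw [Submodule.span_mul_span, Set.singleton_mul_singleton]
    simp [Submodule.one_eq_span]

theorem mem_spanUnit_mul {L : Type*} [CommRing L] {A : Subalgebra ℤ L} {c : Lˣ}
    {u : (Submodule ↥A L)ˣ} {x : L} :
    x ∈ ((spanUnit A c * u : (Submodule ↥A L)ˣ) : Submodule ↥A L) ↔
      ∃ y ∈ (u : Submodule ↥A L), (c : L) * y = x :=
  Submodule.mem_span_singleton_mul

theorem picCls_spanUnit_mul {L : Type*} [CommRing L] (A : Subalgebra ℤ L) (c : Lˣ)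
    (u : (Submodule ↥A L)ˣ) : picCls A (spanUnit A c * u) = picCls A u := by
  have h : spanUnit A c ∈ principalSub A := ⟨c, c.isUnit, rfl⟩
  rw [mul_comm]
  exact QuotientGroup.mk_mul_of_mem u h

theorem exists_eq_spanUnit_mul_of_picCls_eq {L : Type*} [CommRing L] {A : Subalgebra ℤ L}
    {u v : (Submodule ↥A L)ˣ} (h : picCls A u = picCls A v) :
    ∃ c : Lˣ, v = spanUnit A c * u := by
  obtain ⟨x, hx, hxe⟩ := QuotientGroup.eq.mp h
  refine ⟨hx.unit, ?_⟩
  have : u⁻¹ * v = spanUnit A hx.unit := Units.ext hxe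
  rw [← this, mul_comm, mul_inv_cancel_left]

theorem coe_ne_bot {L : Type*} [CommRing L] [Nontrivial L] {A : Subalgebra ℤ L}
    (u : (Submodule ↥A L)ˣ) : (u : Submodule ↥A L) ≠ ⊥ := by
  have : Nontrivial (Submodule ↥A L) := inferInstance
  exact u.ne_zero

section Picard

open NumberField nonZeroDivisors

variable {F : Type*} [Field F] [NumberField F]

theorem finite_of_isZOrder {A : Subalgebra ℤ F} (hA : IsZOrder A) : Module.Finite ℤ A :=
  Module.Finite.iff_fg.mpr hA.1

theorem fg_span_ringOfIntegers {A : Subalgebra ℤ F} (hA : IsZOrder A) (u : (Submodule ↥A F)ˣ) :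
    (Submodule.span (𝓞 F) ((u : Submodule ↥A F) : Set F)).FG := by
  have := finite_of_isZOrder hA
  have : Module.Finite ↥A (u : Submodule ↥A F) := Module.Finite.iff_fg.mpr (Submodule.fg_unit u)
  have : Module.Finite ℤ (u : Submodule ↥A F) := Module.Finite.trans ↥A _
  obtain ⟨T, hT⟩ : ((u : Submodule ↥A F).restrictScalars ℤ).FG := Module.Finite.iff_fg.mp this
  refine ⟨T, ?_⟩
  rw [← Submodule.span_span_of_tower ℤ (𝓞 F) (T : Set F), hT]
  rfl

/-- The fractional ideal of `𝓞 F` generated by an invertible fractional `A`-ideal. -/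
def extendMaximal {A : Subalgebra ℤ F} (hA : IsZOrder A) (u : (Submodule ↥A F)ˣ) :
    FractionalIdeal (𝓞 F)⁰ F :=
  ⟨Submodule.span (𝓞 F) ((u : Submodule ↥A F) : Set F),
    FractionalIdeal.isFractional_of_fg (fg_span_ringOfIntegers hA u)⟩

theorem extendMaximal_ne_zero {A : Subalgebra ℤ F} (hA : IsZOrder A) (u : (Submodule ↥A F)ˣ) :
    extendMaximal hA u ≠ 0 := by
  intro h
  obtain ⟨x, hx, hx0⟩ := Submodule.exists_mem_ne_zero_of_ne_bot (coe_ne_bot u)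
  have : x ∈ extendMaximal hA u := Submodule.subset_span hx
  rw [h, FractionalIdeal.mem_zero_iff] at this
  exact hx0 this

theorem exists_zsmul_ringOfIntegers_mem {A : Subalgebra ℤ F} (hA : IsZOrder A) :
    ∃ m : ℤ, m ≠ 0 ∧ ∀ o : 𝓞 F, m • (o : F) ∈ A := by
  let J : Submodule ℤ F := LinearMap.range (Algebra.linearMap (𝓞 F) F |>.restrictScalars ℤ)
  have hJ : J.FG := Module.Finite.iff_fg.mp (Module.Finite.range _)
  obtain ⟨m, hm, h⟩ := exists_zsmul_mem_of_le_span_rat (Subalgebra.toSubmodule A) hJ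
    fun v _ => by
      have : v ∈ (⊤ : Submodule ℚ F) := trivial
      rwa [← hA.2] at this
  exact ⟨m, hm, fun o => h o ⟨o, rfl⟩⟩

theorem zsmul_mem_of_mem_span_ringOfIntegers {A : Subalgebra ℤ F} {m : ℤ}
    (hm : ∀ o : 𝓞 F, m • (o : F) ∈ A) (u : Submodule ↥A F) {x : F}
    (hx : x ∈ Submodule.span (𝓞 F) (u : Set F)) : m • x ∈ u := by
  suffices h : ∀ o : 𝓞 F, m • o • x ∈ u by simpa using h 1
  induction hx using Submodule.span_induction with
  | mem x hx =>
    intro o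
    have := u.smul_mem ⟨_, hm o⟩ hx
    rwa [Subalgebra.smul_def, smul_assoc] at this
  | zero => simp
  | add x y _ _ hx hy =>
    intro o
    rw [smul_add, smul_add]
    exact u.add_mem (hx o) (hy o)
  | smul r x _ hx =>
    intro o
    rw [← mul_smul]
    exact hx (o * r)

theorem finite_picard {A : Subalgebra ℤ F} (hA : IsZOrder A) : Finite (Picard A) := by
  classical
  obtain ⟨m, hm0, hm⟩ := exists_zsmul_ringOfIntegers_mem hA
  let Q := (FractionalIdeal (𝓞 F)⁰ F)ˣ ⧸ (toPrincipalIdeal (𝓞 F) F).range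
  have : Finite Q := Finite.of_equiv _ (ClassGroup.equiv (R := 𝓞 F) F).toEquiv
  let κ : (Submodule ↥A F)ˣ → Q := fun u =>
    QuotientGroup.mk (Units.mk0 (extendMaximal hA u) (extendMaximal_ne_zero hA u))
  let r : Q → (Submodule ↥A F)ˣ := fun q => if h : ∃ u, κ u = q then h.choose else 1
  have hr : ∀ u, κ (r (κ u)) = κ u := fun u => by
    have h : ∃ v, κ v = κ u := ⟨u, rfl⟩
    simp only [r, dif_pos h]
    exact h.choose_spec
  let I : Q → Submodule ℤ F := fun q =>
    (Submodule.span (𝓞 F) ((r q : Submodule ↥A F) : Set F)).restrictScalars ℤ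
  have hI : ∀ q, (I q).FG := fun q => by
    have : Module.Finite (𝓞 F) (Submodule.span (𝓞 F) ((r q : Submodule ↥A F) : Set F)) :=
      Module.Finite.iff_fg.mpr (fg_span_ringOfIntegers hA _)
    have : Module.Finite ℤ (Submodule.span (𝓞 F) ((r q : Submodule ↥A F) : Set F)) :=
      Module.Finite.trans (𝓞 F) _
    exact Module.Finite.iff_fg.mp this
  let S : Q → Set (Submodule ↥A F)ˣ := fun q =>
    {w | (w : Submodule ↥A F).restrictScalars ℤ ≤ I q ∧
      ∀ v ∈ I q, m • v ∈ (w : Submodule ↥A F).restrictScalars ℤ}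
  have hS : ∀ q, (S q).Finite := fun q =>
    Set.Finite.preimage
      (f := fun w : (Submodule ↥A F)ˣ => (w : Submodule ↥A F).restrictScalars ℤ)
      (fun _ _ _ _ h => Units.ext (Submodule.restrictScalars_injective ℤ ↥A F h))
      (finite_setOf_submodule_between (hI q) hm0)
  have hfin : (picCls A '' ⋃ q, S q).Finite := (Set.finite_iUnion hS).image _
  refine Set.finite_univ_iff.mp (hfin.subset fun p _ => ?_)
  obtain ⟨u, rfl⟩ := QuotientGroup.mk_surjective p
  obtain ⟨c, hc⟩ := QuotientGroup.eq.mp (hr u)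
  rw [toPrincipalIdeal_eq_iff] at hc
  have hc' : extendMaximal hA u = FractionalIdeal.spanSingleton (𝓞 F)⁰ (c : F) *
      extendMaximal hA (r (κ u)) := by
    have h1 : Units.mk0 (extendMaximal hA u) (extendMaximal_ne_zero hA u) =
        toPrincipalIdeal (𝓞 F) F c *
          Units.mk0 (extendMaximal hA (r (κ u))) (extendMaximal_ne_zero hA _) := by
      rw [(toPrincipalIdeal_eq_iff).mpr hc, mul_comm, mul_inv_cancel_left]
    simpa using congrArg Units.val h1
  have hmem : ∀ x, x ∈ I (κ u) ↔
      (c : F) * x ∈ Submodule.span (𝓞 F) ((u : Submodule ↥A F) : Set F) := fun x => by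
    change x ∈ extendMaximal hA (r (κ u)) ↔ (c : F) * x ∈ extendMaximal hA u
    rw [hc', FractionalIdeal.mem_singleton_mul]
    exact ⟨fun h => ⟨x, h, rfl⟩, fun ⟨y, hy, e⟩ => mul_left_cancel₀ c.ne_zero e ▸ hy⟩
  refine ⟨spanUnit A c⁻¹ * u, Set.mem_iUnion.mpr ⟨κ u, ?_, ?_⟩, picCls_spanUnit_mul A _ u⟩
  · intro x hx
    obtain ⟨y, hy, rfl⟩ := mem_spanUnit_mul.mp hx
    rw [hmem, Units.mul_inv_cancel_left]
    exact Submodule.subset_span hy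
  · intro x hx
    refine mem_spanUnit_mul.mpr ⟨m • ((c : F) * x),
      zsmul_mem_of_mem_span_ringOfIntegers hm _ ((hmem x).mp hx), ?_⟩
    rw [mul_smul_comm, Units.inv_mul_cancel_left]

end Picard

section Units

open NumberField

variable {F : Type*} [Field F] [NumberField F]

theorem isIntegral_of_mem_isZOrder {A : Subalgebra ℤ F} (hA : IsZOrder A) {x : F} (hx : x ∈ A) :
    IsIntegral ℤ x :=
  IsIntegral.of_mem_of_fg A hA.1 x hx

theorem fg_units_of_isZOrder {A : Subalgebra ℤ F} (hA : IsZOrder A) : Group.FG (↥A)ˣ := by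
  let i : ↥A →+* 𝓞 F :=
    { toFun := fun a => ⟨a, isIntegral_of_mem_isZOrder hA a.2⟩
      map_one' := rfl
      map_mul' := fun _ _ => rfl
      map_zero' := rfl
      map_add' := fun _ _ => rfl }
  have hi : Function.Injective i := fun a b h => Subtype.ext (congrArg (fun y : 𝓞 F => (y : F)) h)
  let j : Additive (↥A)ˣ →ₗ[ℤ] Additive (𝓞 F)ˣ :=
    (MonoidHom.toAdditive (Units.map (i : ↥A →* 𝓞 F))).toIntLinearMap
  have hj : Function.Injective j := Units.map_injective hi
  have : Module.Finite ℤ (Additive (↥A)ˣ) := Module.Finite.of_injective j hj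
  rw [GroupFG.iff_add_fg, ← Module.Finite.iff_addGroup_fg]
  infer_instance

theorem exists_unit_of_span_singleton_eq {A : Subalgebra ℤ F} {f g : F} (hf : f ≠ 0)
    (h : Submodule.span ↥A {f} = Submodule.span ↥A {g}) :
    ∃ ε : (↥A)ˣ, g = ((ε : ↥A) : F) * f := by
  obtain ⟨a, ha⟩ := Submodule.mem_span_singleton.mp (h ▸ Submodule.mem_span_singleton_self g)
  obtain ⟨b, hb⟩ := Submodule.mem_span_singleton.mp (h ▸ Submodule.mem_span_singleton_self f)
  rw [Subalgebra.smul_def, smul_eq_mul] at ha hb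
  refine ⟨Units.mkOfMulEqOne a b (Subtype.ext (mul_right_cancel₀ hf ?_)), ha.symm⟩
  push_cast
  rw [one_mul]
  calc (a : F) * b * f = b * (a * f) := by ring
    _ = f := by rw [ha, hb]

theorem exists_finite_roots_mod_units {A : Subalgebra ℤ F} (hA : IsZOrder A) {N : ℕ}
    (hN : N ≠ 0) (I : Submodule ↥A F) (L : Type*) [Field L] [Algebra F L] :
    ∃ T : Set L, T.Finite ∧ ∀ (x : L) (f : F), f ≠ 0 → x ^ N = algebraMap F L f →
      I = Submodule.span ↥A {f} →
      ∃ (ε : (↥A)ˣ) (t : L), t ∈ T ∧ x = algebraMap F L ((ε : ↥A) : F) * t := by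
  by_cases hex : ∃ f₀ : F, f₀ ≠ 0 ∧ I = Submodule.span ↥A {f₀}
  swap
  · exact ⟨∅, Set.finite_empty, fun x f hf _ h => absurd ⟨f, hf, h⟩ hex⟩
  obtain ⟨f₀, hf₀, hI₀⟩ := hex
  have := fg_units_of_isZOrder hA
  have := Subgroup.finiteIndex_range_powMonoidHom_of_fg (↥A)ˣ hN
  have : Finite ((↥A)ˣ ⧸ (powMonoidHom (α := (↥A)ˣ) N).range) :=
    Subgroup.finite_quotient_of_finiteIndex
  refine ⟨⋃ q : (↥A)ˣ ⧸ (powMonoidHom (α := (↥A)ˣ) N).range,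
    {t | t ^ N = algebraMap F L (((q.out : (↥A)ˣ) : ↥A) * f₀)}, Set.finite_iUnion fun q => ?_, ?_⟩
  · classical
    refine (Polynomial.nthRoots N
      (algebraMap F L (((q.out : (↥A)ˣ) : ↥A) * f₀))).toFinset.finite_toSet.subset fun t ht => ?_
    simpa [Polynomial.mem_nthRoots (Nat.pos_of_ne_zero hN)] using ht
  · intro x f hf hx hI
    obtain ⟨δ, rfl⟩ := exists_unit_of_span_singleton_eq hf₀ (hI₀.symm.trans hI)
    obtain ⟨ε, hε⟩ := QuotientGroup.eq.mp
      (QuotientGroup.out_eq' (δ : (↥A)ˣ ⧸ (powMonoidHom (α := (↥A)ˣ) N).range))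
    have hδ : δ = (δ : (↥A)ˣ ⧸ (powMonoidHom (α := (↥A)ˣ) N).range).out * ε ^ N := by
      rw [← powMonoidHom_apply, hε, mul_inv_cancel_left]
    have hεF : ((ε : ↥A) : F) * ((ε⁻¹ : (↥A)ˣ) : ↥A) = 1 := by
      exact_mod_cast congrArg (Subtype.val) ε.mul_inv
    refine ⟨ε, algebraMap F L ((ε⁻¹ : (↥A)ˣ) : ↥A) * x, Set.mem_iUnion.mpr ⟨δ, ?_⟩, ?_⟩
    · have h1 : (((δ : ↥A) : F)) =
          (((δ : (↥A)ˣ ⧸ (powMonoidHom (α := (↥A)ˣ) N).range).out : (↥A)ˣ) : ↥A) *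
            ((ε : ↥A) : F) ^ N := by
        exact_mod_cast congrArg (fun y : (↥A)ˣ => ((y : ↥A) : F)) hδ
      change (_ * x) ^ N = _
      rw [mul_pow, hx, ← map_pow, ← map_mul]
      congr 1
      have key : ∀ r e e' g : F, e * e' = 1 → e' ^ N * (r * e ^ N * g) = r * g := by
        intro r e e' g he
        have := congrArg (· ^ N) he
        simp only [mul_pow, one_pow] at this
        linear_combination r * g * this
      rw [h1, key _ _ _ _ hεF]
    · rw [← mul_assoc, ← map_mul, hεF, map_one, one_mul]

end Units

section CMOrders

open scoped IntermediateField

variable {F : Type*} [Field F]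

theorem extIdeal_mul {A : Subalgebra ℤ F} (B : Subalgebra ℤ (AlgebraicClosure F))
    (a b : Submodule ↥A F) : extIdeal B (a * b) = extIdeal B a * extIdeal B b := by
  apply le_antisymm
  · refine Submodule.span_le.mpr ?_
    rintro _ ⟨x, hx, rfl⟩
    induction hx using Submodule.mul_induction_on' with
    | mem_mul_mem m hm n hn =>
      rw [map_mul]
      exact Submodule.mul_mem_mul (Submodule.subset_span ⟨m, hm, rfl⟩)
        (Submodule.subset_span ⟨n, hn, rfl⟩)
    | add x _ y _ hx hy =>
      rw [map_add]
      exact Submodule.add_mem _ hx hy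
  · rw [extIdeal, extIdeal, Submodule.span_mul_span]
    refine Submodule.span_le.mpr ?_
    rintro _ ⟨_, ⟨m, hm, rfl⟩, _, ⟨n, hn, rfl⟩, rfl⟩
    exact Submodule.subset_span ⟨m * n, Submodule.mul_mem_mul hm hn, map_mul _ _ _⟩

variable [NumberField F] {A : Subalgebra ℤ F} (C : CMOrder A)

theorem extIdeal_span_singleton (f : F) :
    extIdeal C.B (Submodule.span ↥A {f}) =
      Submodule.span ↥C.B {algebraMap F (AlgebraicClosure F) f} := by
  apply le_antisymm
  · refine Submodule.span_le.mpr ?_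
    rintro _ ⟨x, hx, rfl⟩
    obtain ⟨a, rfl⟩ := Submodule.mem_span_singleton.mp hx
    refine Submodule.mem_span_singleton.mpr ⟨⟨_, (C.proper a).mpr a.2⟩, ?_⟩
    rw [Subalgebra.smul_def, Subalgebra.smul_def, smul_eq_mul, smul_eq_mul, map_mul]
  · rw [Submodule.span_singleton_le_iff_mem]
    exact Submodule.subset_span ⟨f, Submodule.mem_span_singleton_self f, rfl⟩

theorem extIdeal_pow (a : Submodule ↥A F) (n : ℕ) :
    extIdeal C.B (a ^ n) = extIdeal C.B a ^ n := by
  induction n with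
  | zero =>
    rw [pow_zero, pow_zero, Submodule.one_eq_span, Submodule.one_eq_span,
      extIdeal_span_singleton, map_one]
  | succ n ih => rw [pow_succ, pow_succ, extIdeal_mul, ih]

theorem extIdeal_pow_eq_span {a : Submodule ↥A F} {x : AlgebraicClosure F}
    (h : extIdeal C.B a = Submodule.span ↥C.B {x}) (n : ℕ) :
    extIdeal C.B (a ^ n) = Submodule.span ↥C.B {x ^ n} := by
  rw [extIdeal_pow, h, Submodule.span_pow, Set.singleton_pow]

theorem coe_eq_span_singleton_of_extIdeal_eq {u : (Submodule ↥A F)ˣ} {f : F}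
    (h : extIdeal C.B (u : Submodule ↥A F) =
      Submodule.span ↥C.B {algebraMap F (AlgebraicClosure F) f}) :
    (u : Submodule ↥A F) = Submodule.span ↥A {f} := by
  by_cases hf : f = 0
  · subst hf
    exfalso
    obtain ⟨x, hx, hx0⟩ := Submodule.exists_mem_ne_zero_of_ne_bot (coe_ne_bot u)
    have hx' : algebraMap F (AlgebraicClosure F) x ∈ extIdeal C.B (u : Submodule ↥A F) :=
      Submodule.subset_span ⟨x, hx, rfl⟩
    rw [h] at hx'
    simp [hx0] at hx'
  apply le_antisymm
  · intro x hx
    have hx' : algebraMap F (AlgebraicClosure F) x ∈ extIdeal C.B (u : Submodule ↥A F) :=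
      Submodule.subset_span ⟨x, hx, rfl⟩
    rw [h] at hx'
    obtain ⟨b, hb⟩ := Submodule.mem_span_singleton.mp hx'
    have hb' : (b : AlgebraicClosure F) = algebraMap F (AlgebraicClosure F) (x / f) := by
      rw [map_div₀, eq_div_iff (by simpa using hf), ← hb, Subalgebra.smul_def, smul_eq_mul]
    refine Submodule.mem_span_singleton.mpr ⟨⟨x / f, (C.proper _).mp (hb' ▸ b.2)⟩, ?_⟩
    rw [Subalgebra.smul_def, smul_eq_mul, div_mul_cancel₀ _ hf]
  · have hsub : ((u⁻¹ : (Submodule ↥A F)ˣ) : Submodule ↥A F) * Submodule.span ↥A {f} ≤ 1 := by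
      rw [Submodule.mul_le]
      intro y hy z hz
      obtain ⟨a, rfl⟩ := Submodule.mem_span_singleton.mp hz
      rw [mul_smul_comm]
      refine Submodule.smul_mem _ _ (Submodule.mem_one.mpr ⟨⟨y * f, (C.proper _).mp ?_⟩, rfl⟩)
      rw [map_mul]
      have hle : extIdeal C.B (u : Submodule ↥A F) ≤
          Submodule.comap (LinearMap.mulLeft ↥C.B (algebraMap F (AlgebraicClosure F) y))
            (1 : Submodule ↥C.B (AlgebraicClosure F)) := by
        refine Submodule.span_le.mpr ?_
        rintro _ ⟨x, hx, rfl⟩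
        have hyx : y * x ∈ (1 : Submodule ↥A F) := by
          rw [← Units.val_one, ← inv_mul_cancel u]
          exact Submodule.mul_mem_mul hy hx
        obtain ⟨a', ha'⟩ := Submodule.mem_one.mp hyx
        refine Submodule.mem_one.mpr ⟨⟨_, (C.proper _).mpr a'.2⟩, ?_⟩
        rw [LinearMap.mulLeft_apply, ← map_mul, ← ha']
        rfl
      have hfm : algebraMap F (AlgebraicClosure F) f ∈ extIdeal C.B (u : Submodule ↥A F) :=
        h ▸ Submodule.mem_span_singleton_self _
      obtain ⟨b, hb⟩ := Submodule.mem_one.mp (hle hfm)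
      rw [LinearMap.mulLeft_apply] at hb
      rw [← hb]
      exact b.2
    calc Submodule.span ↥A {f}
        = (u : Submodule ↥A F) *
            (((u⁻¹ : (Submodule ↥A F)ˣ) : Submodule ↥A F) * Submodule.span ↥A {f}) := by
          rw [Units.mul_inv_cancel_left]
      _ ≤ (u : Submodule ↥A F) * 1 := mul_le_mul_right hsub _
      _ = u := mul_one _

theorem adjoin_toSubalgebra_eq :
    (IntermediateField.adjoin F (C.B : Set (AlgebraicClosure F))).toSubalgebra =
      Algebra.adjoin F (C.B : Set (AlgebraicClosure F)) :=
  IntermediateField.adjoin_toSubalgebra_of_isAlgebraic fun x _ =>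
    Algebra.IsAlgebraic.isAlgebraic x

theorem finrank_adjoin :
    Module.finrank F (IntermediateField.adjoin F (C.B : Set (AlgebraicClosure F))) = 2 := by
  rw [← C.quadratic, ← adjoin_toSubalgebra_eq C]
  rfl

theorem isEmpty_adjoin_real :
    IsEmpty (IntermediateField.adjoin F (C.B : Set (AlgebraicClosure F)) →+* ℝ) := by
  have h := C.imaginary
  rw [← adjoin_toSubalgebra_eq C] at h
  exact h

theorem numberField_intermediateField (E : IntermediateField F (AlgebraicClosure F))
    [FiniteDimensional F E] : NumberField E where
  to_finiteDimensional := Module.Finite.trans F E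

theorem isIntegral_of_mem {x : AlgebraicClosure F} (hx : x ∈ C.B) : IsIntegral ℤ x :=
  IsIntegral.of_mem_of_fg C.B C.fg x hx

theorem mem_adjoin_of_mem_extIdeal {a : Submodule ↥A F} {x : AlgebraicClosure F}
    (hx : x ∈ extIdeal C.B a) :
    x ∈ IntermediateField.adjoin F (C.B : Set (AlgebraicClosure F)) := by
  induction hx using Submodule.span_induction with
  | mem x hx =>
    obtain ⟨y, _, rfl⟩ := hx
    exact IntermediateField.algebraMap_mem _ y
  | zero => exact zero_mem _
  | add x y _ _ hx hy => exact add_mem hx hy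
  | smul b x _ hx =>
    rw [Subalgebra.smul_def, smul_eq_mul]
    exact mul_mem (IntermediateField.subset_adjoin _ _ b.2) hx

theorem exists_pow_factorial_eq_algebraMap (hF : TotReal F) (hA : IsZOrder A)
    {u : (Submodule ↥A F)ˣ} {x : AlgebraicClosure F} (hx : x ≠ 0)
    (h : extIdeal C.B (u : Submodule ↥A F) = Submodule.span ↥C.B {x}) :
    ∃ f : F, algebraMap F (AlgebraicClosure F) f =
      x ^ (2 * (Module.finrank ℚ F * 2)).factorial := by
  let E := IntermediateField.adjoin F (C.B : Set (AlgebraicClosure F))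
  have hE2 : Module.finrank F E = 2 := finrank_adjoin C
  have : FiniteDimensional F E := FiniteDimensional.of_finrank_pos (by omega)
  have : NumberField E := numberField_intermediateField E
  have hdeg : Module.finrank ℚ E = Module.finrank ℚ F * 2 := by
    rw [← hE2, Module.finrank_mul_finrank]
  have := finite_picard hA
  obtain ⟨c, hc⟩ : ∃ c : Fˣ, u ^ Nat.card (Picard A) = spanUnit A c * 1 := by
    refine exists_eq_spanUnit_mul_of_picCls_eq (Eq.symm ?_)
    change (QuotientGroup.mk u : Picard A) ^ Nat.card (Picard A) = 1
    exact pow_card_eq_one'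
  have hspan : Submodule.span ↥C.B {x ^ Nat.card (Picard A)} =
      Submodule.span ↥C.B {algebraMap F (AlgebraicClosure F) c} := by
    rw [← extIdeal_pow_eq_span C h, ← extIdeal_span_singleton, ← Units.val_pow_eq_pow_val, hc,
      mul_one]
    rfl
  obtain ⟨b, hb⟩ := Submodule.mem_span_singleton.mp
    (hspan ▸ Submodule.mem_span_singleton_self (x ^ Nat.card (Picard A)))
  obtain ⟨d, hd⟩ := Submodule.mem_span_singleton.mp
    (hspan.symm ▸ Submodule.mem_span_singleton_self (algebraMap F (AlgebraicClosure F) (c : F)))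
  rw [Subalgebra.smul_def, smul_eq_mul] at hb hd
  have hxE : x ∈ E := mem_adjoin_of_mem_extIdeal C (h ▸ Submodule.mem_span_singleton_self x)
  have hBE : ∀ y ∈ C.B, y ∈ E := fun y hy => IntermediateField.subset_adjoin _ _ hy
  have hint : ∀ (y : AlgebraicClosure F) (hy : y ∈ C.B), IsIntegral ℤ (⟨y, hBE y hy⟩ : E) :=
    fun y hy => (isIntegral_algHom_iff (E.val.restrictScalars ℤ) E.val.injective).mp
      (isIntegral_of_mem C hy)
  have hbd : (b : AlgebraicClosure F) * d = 1 := by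
    refine mul_right_cancel₀ (pow_ne_zero (Nat.card (Picard A)) hx) ?_
    rw [mul_assoc, hd, hb, one_mul]
  obtain ⟨f, hf⟩ := pow_factorial_mem_range_of_pow_eq_mul_unit (F := F) (K := E) hF hE2
    (isEmpty_adjoin_real C) (x := ⟨x, hxE⟩) (fun h0 => hx (congrArg Subtype.val h0))
    (h := Nat.card (Picard A)) Nat.card_pos.ne' (c := c) (hint b b.2) (hint d d.2)
    (Subtype.ext hbd) (Subtype.ext (by
      change x ^ _ = algebraMap F (AlgebraicClosure F) c * b
      rw [← hb, mul_comm]))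
  rw [hdeg] at hf
  exact ⟨f, congrArg Subtype.val hf⟩

end CMOrders

section Finiteness

open NumberField
open scoped IntermediateField

variable {F : Type*} [Field F] [NumberField F] {A : Subalgebra ℤ F}

theorem adjoin_eq_adjoin_simple (C : CMOrder A) {z : AlgebraicClosure F} (hz : z ∈ C.B)
    (hzF : z ∉ Set.range (algebraMap F (AlgebraicClosure F))) :
    IntermediateField.adjoin F (C.B : Set (AlgebraicClosure F)) = F⟮z⟯ := by
  have hE2 := finrank_adjoin C
  have : FiniteDimensional F (IntermediateField.adjoin F (C.B : Set (AlgebraicClosure F))) :=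
    FiniteDimensional.of_finrank_pos (by omega)
  have hle : F⟮z⟯ ≤ IntermediateField.adjoin F (C.B : Set (AlgebraicClosure F)) :=
    IntermediateField.adjoin_simple_le_iff.mpr (IntermediateField.subset_adjoin _ _ hz)
  refine (IntermediateField.eq_of_le_of_finrank_eq hle ?_).symm
  rw [hE2]
  have hdvd : Module.finrank F F⟮z⟯ ∣ 2 := hE2 ▸ IntermediateField.finrank_dvd_of_le_right hle
  refine ((Nat.dvd_prime Nat.prime_two).mp hdvd).resolve_left fun h1 => hzF ?_
  rw [IntermediateField.finrank_eq_one_iff] at h1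
  exact IntermediateField.mem_bot.mp (h1 ▸ IntermediateField.mem_adjoin_simple_self F z)

theorem mem_span_rat_adjoin (hA : IsZOrder A) {L : Type*} [Field L] [Algebra F L] [Algebra ℚ L]
    (z : L) {x : L} (hx : x ∈ Algebra.adjoin F {z}) :
    x ∈ Submodule.span ℚ
      ((Algebra.adjoin ℤ (algebraMap F L '' A ∪ {z}) : Subalgebra ℤ L) : Set L) := by
  let R : Subalgebra ℤ L := Algebra.adjoin ℤ (algebraMap F L '' A ∪ {z})
  have hspan : ∀ y ∈ R, y ∈ Submodule.span ℚ (R : Set L) := fun y hy => Submodule.subset_span hy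
  induction hx using Algebra.adjoin_induction with
  | mem x hx => exact hspan x (Algebra.subset_adjoin (Or.inr hx))
  | algebraMap f =>
    have hf : f ∈ Submodule.span ℚ (A : Set F) := hA.2 ▸ Submodule.mem_top
    have h := Submodule.mem_map_of_mem (f := (algebraMap F L).toAddMonoidHom.toRatLinearMap) hf
    rw [Submodule.map_span] at h
    refine Submodule.span_mono ?_ h
    exact fun y hy => Algebra.subset_adjoin (Or.inl hy)
  | add x y _ _ hx hy => exact Submodule.add_mem _ hx hy
  | mul x y _ _ hx hy =>
    have h := Submodule.mul_mem_mul hx hy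
    rw [Submodule.span_mul_span] at h
    refine Submodule.span_mono ?_ h
    rintro _ ⟨p, hp, q, hq, rfl⟩
    exact R.mul_mem hp hq

theorem finite_setOf_mem_CMOrder (hA : IsZOrder A) {z : AlgebraicClosure F}
    (hzF : z ∉ Set.range (algebraMap F (AlgebraicClosure F))) :
    {C : CMOrder A | z ∈ C.B}.Finite := by
  have : FiniteDimensional F F⟮z⟯ :=
    IntermediateField.adjoin.finiteDimensional (Algebra.IsIntegral.isIntegral z)
  have : NumberField F⟮z⟯ := numberField_intermediateField F⟮z⟯
  let i : 𝓞 F⟮z⟯ →ₗ[ℤ] AlgebraicClosure F :=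
    (F⟮z⟯.val.toRingHom.comp (algebraMap (𝓞 F⟮z⟯) F⟮z⟯)).toAddMonoidHom.toIntLinearMap
  let R : Subalgebra ℤ (AlgebraicClosure F) :=
    Algebra.adjoin ℤ (algebraMap F (AlgebraicClosure F) '' A ∪ {z})
  have hJ : (LinearMap.range i).FG := Module.Finite.iff_fg.mp (Module.Finite.range i)
  obtain ⟨m, hm0, hm⟩ := exists_zsmul_mem_of_le_span_rat (Subalgebra.toSubmodule R) hJ (by
    rintro _ ⟨o, rfl⟩
    refine mem_span_rat_adjoin hA z ?_
    rw [← IntermediateField.adjoin_simple_toSubalgebra_of_isAlgebraic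
      (Algebra.IsAlgebraic.isAlgebraic z)]
    exact (o : F⟮z⟯).2)
  have hinj : Function.Injective fun C : CMOrder A => Subalgebra.toSubmodule C.B := by
    intro C C' h
    have := Subalgebra.toSubmodule_injective h
    cases C
    cases C'
    cases this
    rfl
  refine ((finite_setOf_submodule_between hJ hm0).preimage hinj.injOn).subset fun C hC => ⟨?_, ?_⟩
  · intro b hb
    have hbE : b ∈ F⟮z⟯ :=
      adjoin_eq_adjoin_simple C hC hzF ▸ IntermediateField.subset_adjoin _ _ hb
    have hint : IsIntegral ℤ (⟨b, hbE⟩ : F⟮z⟯) :=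
      (isIntegral_algHom_iff (F⟮z⟯.val.restrictScalars ℤ) F⟮z⟯.val.injective).mp
        (isIntegral_of_mem C hb)
    exact ⟨⟨_, hint⟩, rfl⟩
  · intro v hv
    have hRB : R ≤ C.B := by
      refine Algebra.adjoin_le (Set.union_subset ?_ (Set.singleton_subset_iff.mpr hC))
      rintro _ ⟨a, ha, rfl⟩
      exact (C.proper a).mpr ha
    exact hRB (hm v hv)

theorem exists_finite_meeting_capitulating_orders (hF : TotReal F) (hA : IsZOrder A)
    (a : (Submodule ↥A F)ˣ) (ha : ¬ IsPrincipalIdl A (a : Submodule ↥A F)) :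
    ∃ Z : Set (AlgebraicClosure F), Z.Finite ∧
      Z ∩ Set.range (algebraMap F (AlgebraicClosure F)) = ∅ ∧
      ∀ C : CMOrder A, Capitulates C.B (a : Submodule ↥A F) → ∃ z ∈ Z, z ∈ C.B := by
  obtain ⟨T, hT, hTx⟩ := exists_finite_roots_mod_units hA
    (Nat.factorial_ne_zero (2 * (Module.finrank ℚ F * 2)))
    ((a : Submodule ↥A F) ^ (2 * (Module.finrank ℚ F * 2)).factorial) (AlgebraicClosure F)
  obtain ⟨α, hα, hα0⟩ := Submodule.exists_mem_ne_zero_of_ne_bot (coe_ne_bot a)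
  refine ⟨((fun t => algebraMap F (AlgebraicClosure F) α / t) '' T) \
    Set.range (algebraMap F (AlgebraicClosure F)), (hT.image _).sdiff, by simp, ?_⟩
  rintro C ⟨x, hx, hax⟩
  obtain ⟨f, hf⟩ := exists_pow_factorial_eq_algebraMap C hF hA hx hax
  have hf0 : f ≠ 0 := by
    rintro rfl
    rw [map_zero] at hf
    exact pow_ne_zero _ hx hf.symm
  have hpow := extIdeal_pow_eq_span C hax (2 * (Module.finrank ℚ F * 2)).factorial
  rw [← hf, ← Units.val_pow_eq_pow_val] at hpow
  have hspan := coe_eq_span_singleton_of_extIdeal_eq C hpow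
  rw [Units.val_pow_eq_pow_val] at hspan
  obtain ⟨ε, t, ht, rfl⟩ := hTx x f hf0 hf.symm hspan
  have hα' : algebraMap F (AlgebraicClosure F) α ∈ extIdeal C.B (a : Submodule ↥A F) :=
    Submodule.subset_span ⟨α, hα, rfl⟩
  rw [hax] at hα'
  obtain ⟨b, hb⟩ := Submodule.mem_span_singleton.mp hα'
  rw [Subalgebra.smul_def, smul_eq_mul] at hb
  have ht0 : t ≠ 0 := right_ne_zero_of_mul hx
  have hz : algebraMap F (AlgebraicClosure F) α / t =
      b * algebraMap F (AlgebraicClosure F) ((ε : ↥A) : F) := by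
    rw [div_eq_iff ht0, ← hb, mul_assoc]
  refine ⟨algebraMap F (AlgebraicClosure F) α / t, ⟨⟨t, ht, rfl⟩, ?_⟩, ?_⟩
  · rintro ⟨g, hg⟩
    have hα0' : algebraMap F (AlgebraicClosure F) α ≠ 0 := by simpa using hα0
    have hg0 : algebraMap F (AlgebraicClosure F) g ≠ 0 := hg ▸ div_ne_zero hα0' ht0
    have htF : t = algebraMap F (AlgebraicClosure F) (α / g) := by
      rw [map_div₀, eq_div_iff hg0, hg, mul_div_cancel₀ _ ht0]
    rw [htF, ← map_mul] at hax
    refine ha ⟨_, ?_, coe_eq_span_singleton_of_extIdeal_eq C hax⟩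
    rintro h0
    rw [htF, ← map_mul, h0, map_zero] at hx
    exact hx rfl
  · rw [hz]
    exact mul_mem b.2 ((C.proper _).mpr (ε : ↥A).2)

theorem finite_setOf_capitulates (hF : TotReal F) (hA : IsZOrder A)
    (a : (Submodule ↥A F)ˣ) (ha : ¬ IsPrincipalIdl A (a : Submodule ↥A F)) :
    {C : CMOrder A | Capitulates C.B (a : Submodule ↥A F)}.Finite := by
  obtain ⟨Z, hZ, hZF, hZC⟩ := exists_finite_meeting_capitulating_orders hF hA a ha
  refine (hZ.biUnion fun z hz => finite_setOf_mem_CMOrder hA (z := z) fun h =>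
    (hZF ▸ ⟨hz, h⟩ : z ∈ (∅ : Set (AlgebraicClosure F)))).subset fun C hC => ?_
  obtain ⟨z, hz, hzC⟩ := hZC C hC
  exact Set.mem_biUnion hz hzC

theorem isPrincipalIdl_spanUnit_mul (c : Fˣ) {u : (Submodule ↥A F)ˣ}
    (h : IsPrincipalIdl A (u : Submodule ↥A F)) :
    IsPrincipalIdl A ((spanUnit A c * u : (Submodule ↥A F)ˣ) : Submodule ↥A F) := by
  obtain ⟨x, hx, hux⟩ := h
  refine ⟨c * x, mul_ne_zero c.ne_zero hx, ?_⟩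
  rw [Units.val_mul, hux]
  exact (Submodule.span_mul_span ..).trans (by rw [Set.singleton_mul_singleton])

theorem capitulates_spanUnit_mul (C : CMOrder A) (c : Fˣ) {u : (Submodule ↥A F)ˣ}
    (h : Capitulates C.B (u : Submodule ↥A F)) :
    Capitulates C.B ((spanUnit A c * u : (Submodule ↥A F)ˣ) : Submodule ↥A F) := by
  obtain ⟨x, hx, hux⟩ := h
  refine ⟨algebraMap F (AlgebraicClosure F) c * x, mul_ne_zero (by simp) hx, ?_⟩
  rw [Units.val_mul, extIdeal_mul, hux]
  change extIdeal C.B (Submodule.span ↥A {(c : F)}) * _ = _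
  rw [extIdeal_span_singleton, Submodule.span_mul_span, Set.singleton_mul_singleton]

theorem finite_setOf_hasNontrivialKernel (hF : TotReal F) (hA : IsZOrder A) :
    {C : CMOrder A | HasNontrivialKernel C}.Finite := by
  have := finite_picard hA
  let r : Picard A → (Submodule ↥A F)ˣ := Quotient.out
  have hr : ∀ p, picCls A (r p) = p := fun p => QuotientGroup.out_eq' p
  have hfin : (⋃ p : Picard A, {C : CMOrder A |
      ¬ IsPrincipalIdl A (r p : Submodule ↥A F) ∧
        Capitulates C.B (r p : Submodule ↥A F)}).Finite := by
    refine Set.finite_iUnion fun p => ?_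
    by_cases hp : IsPrincipalIdl A (r p : Submodule ↥A F)
    · simp [hp]
    · exact (finite_setOf_capitulates hF hA (r p) hp).subset fun C hC => hC.2
  refine hfin.subset ?_
  rintro C ⟨u, hu, huC⟩
  obtain ⟨c, hc⟩ := exists_eq_spanUnit_mul_of_picCls_eq (hr (picCls A u))
  obtain ⟨d, hd⟩ := exists_eq_spanUnit_mul_of_picCls_eq (hr (picCls A u)).symm
  refine Set.mem_iUnion.mpr ⟨picCls A u, fun hp => hu ?_, ?_⟩
  · rw [hc]
    exact isPrincipalIdl_spanUnit_mul c hp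
  · rw [hd]
    exact capitulates_spanUnit_mul C d huC

end Finiteness

theorem finiteness_of_CM_orders_with_nontrivial_kernel
    {F : Type*} [Field F] [NumberField F] (hF : TotReal F)
    (A : Subalgebra ℤ F) (hA : IsZOrder A) :
    Finite (Quot (fun C C' : {C : CMOrder A // HasNontrivialKernel C} =>
      CMIso C.1 C'.1)) := by
  have : Finite {C : CMOrder A // HasNontrivialKernel C} :=
    (finite_setOf_hasNontrivialKernel hF hA).to_subtype
  exact Finite.of_surjective _ Quot.mk_surjective

end
end

section
/- Let F be a totally real number field, A a ℤ-order in F, and K/F a CM extension with ker(i_{O_K/A}) ≠ {1}. Let [a] be a nontrivial class of A in ker(i_{O_K/A}), so that aO_K = λ'O_K for some λ' ∈ K^×. For a CM proper A-order B ⊆ O_K, one has [a] ∈ ker(i_{B/A}) if and only if there exists u ∈ O_K^× such that u·a/λ' ⊆ B. Moreover, if such a unit u exists, then u^{-1}λ' ∉ F^×. -/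
/-!
STATEMENT 8: Let `F` be a totally real number field, `A` a `ℤ`-order in `F`, and `K/F` a CM
extension with `ker (i_{O_K/A}) ≠ {1}`.  Let `[a]` be a nontrivial class of `A` in
`ker (i_{O_K/A})`, so that `a O_K = λ' O_K` for some `λ' ∈ K^×`.  For a CM proper
`A`-order `B ⊆ O_K`, one has `[a] ∈ ker (i_{B/A})` if and only if there exists
`u ∈ O_K^×` such that `u·a/λ' ⊆ B`.  Moreover, if such a unit `u` exists, then
`u⁻¹λ' ∉ F^×`.

Conventions: `a` is an invertible (= locally principal) fractional `A`-ideal, its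
nontriviality means that it is not principal; `[a] ∈ ker (i_{B/A})` means that the extended
ideal `aB` is principal; a unit of `O_K` is an element `u ∈ O_K` with an inverse `v ∈ O_K`.
-/

noncomputable section
set_option synthInstance.maxHeartbeats 1000000
set_option maxHeartbeats 1000000

/-- Let `R` embed into the ring of integers of `K`, and let `I` be an ideal of `R`.  If `S ⊆ I y` and
`y` lies in the module spanned by `S` over the ring of integers, then `I` is the unit ideal. -/
theorem eq_top_of_mem_span_integralClosure {K : Type*} [Field K] {R : Type*} [CommRing R]
    (φ : R →+* ↥(integralClosure ℤ K)) (hφ : Function.Injective φ) (I : Ideal R)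
    {S : Set K} {y : K} (hy : y ≠ 0) (hS : ∀ s ∈ S, ∃ r ∈ I, (φ r : K) * y = s)
    (hyS : y ∈ Submodule.span ↥(integralClosure ℤ K) S) : I = ⊤ := by
  have hint : φ.IsIntegral := by
    refine RingHom.IsIntegral.tower_top (Int.castRingHom R) φ ?_
    rw [RingHom.ext_int (φ.comp (Int.castRingHom R)) (algebraMap ℤ ↥(integralClosure ℤ K))]
    exact algebraMap_isIntegral_iff.mpr inferInstance
  have key : ∀ t ∈ Submodule.span ↥(integralClosure ℤ K) S, ∃ z ∈ I.map φ, (z : K) * y = t := by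
    intro t ht
    induction ht using Submodule.span_induction with
    | mem s hs =>
      obtain ⟨r, hr, h⟩ := hS s hs
      exact ⟨φ r, Ideal.mem_map_of_mem φ hr, h⟩
    | zero => exact ⟨0, Ideal.zero_mem _, by simp⟩
    | add s t _ _ hs ht =>
      obtain ⟨z, hz, rfl⟩ := hs
      obtain ⟨w, hw, rfl⟩ := ht
      exact ⟨z + w, Ideal.add_mem _ hz hw, by push_cast; ring⟩
    | smul c t _ ht =>
      obtain ⟨z, hz, rfl⟩ := ht
      exact ⟨c * z, Ideal.mul_mem_left _ c hz, by
        rw [Algebra.smul_def]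
        change ((c : K) * z) * y = (c : K) * (z * y)
        ring⟩
  obtain ⟨z, hz, hzy⟩ := key y hyS
  have hz1 : z = 1 := Subtype.ext (mul_right_cancel₀ hy (by simpa using hzy))
  rw [hz1, ← Ideal.eq_top_iff_one] at hz
  exact (Ideal.map_eq_top_iff φ hφ hint).mp hz

theorem capitulation_iff_unit_translate_subset
    {F : Type*} [Field F] [NumberField F] (hF : TotReal F)
    {K : Type*} [Field K] [NumberField K] [Algebra F K]
    (hquad : Module.finrank F K = 2) (hCM : IsEmpty (K →+* ℝ))
    (A : Subalgebra ℤ F) (hA : IsZOrder A)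
    -- a nontrivial class `[a] ∈ ker (i_{O_K/A})`, with `a O_K = λ' O_K`
    (a : (Submodule ↥A F)ˣ)
    (hnp : ¬ ∃ x : F, x ≠ 0 ∧ (a : Submodule ↥A F) = Submodule.span ↥A {x})
    (lam' : K) (hlam' : lam' ≠ 0)
    (hext : Submodule.span ↥(integralClosure ℤ K)
        (algebraMap F K '' ((a : Submodule ↥A F) : Set F))
      = Submodule.span ↥(integralClosure ℤ K) {lam'})
    -- `B ⊆ O_K` is a CM proper `A`-order
    (B : Subalgebra ℤ K) (hBO : B ≤ integralClosure ℤ K) (hBfg : IsZOrder B)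
    (hBproper : ∀ x : F, algebraMap F K x ∈ B ↔ x ∈ A) :
    -- `[a] ∈ ker (i_{B/A})  ↔  ∃ u ∈ O_K^×, u·a/λ' ⊆ B`
    ((∃ x : K, x ≠ 0 ∧
        Submodule.span ↥B (algebraMap F K '' ((a : Submodule ↥A F) : Set F))
          = Submodule.span ↥B {x}) ↔
      (∃ u v : K, u ∈ integralClosure ℤ K ∧ v ∈ integralClosure ℤ K ∧ u * v = 1 ∧
        ∀ f ∈ ((a : Submodule ↥A F) : Set F), u * algebraMap F K f * lam'⁻¹ ∈ B)) ∧
    -- moreover, for any such unit `u`, one has `u⁻¹ λ' ∉ F^×`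
    (∀ u v : K, u ∈ integralClosure ℤ K → v ∈ integralClosure ℤ K → u * v = 1 →
      (∀ f ∈ ((a : Submodule ↥A F) : Set F), u * algebraMap F K f * lam'⁻¹ ∈ B) →
      ¬ ∃ g : F, algebraMap F K g = u⁻¹ * lam') := by
  have lam_mem : lam' ∈ Submodule.span ↥(integralClosure ℤ K)
      (algebraMap F K '' ((a : Submodule ↥A F) : Set F)) :=
    hext ▸ Submodule.mem_span_singleton_self lam'
  refine ⟨⟨?_, ?_⟩, ?_⟩
  · rintro ⟨x, hx, hspan⟩
    have coeff : ∀ f ∈ ((a : Submodule ↥A F) : Set F), ∃ b ∈ B, b * x = algebraMap F K f := by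
      intro f hf
      have h : algebraMap F K f ∈ Submodule.span ↥B {x} :=
        hspan ▸ Submodule.subset_span ⟨f, hf, rfl⟩
      obtain ⟨b, hb⟩ := Submodule.mem_span_singleton.mp h
      exact ⟨b, b.2, hb⟩
    have hlam : lam' ∈ Submodule.span ↥(integralClosure ℤ K) {x} := by
      refine (Submodule.span_le.mpr ?_) lam_mem
      rintro _ ⟨f, hf, rfl⟩
      obtain ⟨b, hb, h⟩ := coeff f hf
      exact Submodule.mem_span_singleton.mpr ⟨⟨b, hBO hb⟩, h⟩
    have hxlam : x ∈ Submodule.span ↥(integralClosure ℤ K) {lam'} := by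
      have hxB : x ∈ Submodule.span ↥B (algebraMap F K '' ((a : Submodule ↥A F) : Set F)) :=
        hspan ▸ Submodule.mem_span_singleton_self x
      rw [← hext]
      clear hspan coeff hlam hx
      induction hxB using Submodule.span_induction with
      | mem s hs => exact Submodule.subset_span hs
      | zero => exact Submodule.zero_mem _
      | add s t _ _ hs ht => exact Submodule.add_mem _ hs ht
      | smul c t _ ht =>
        exact Submodule.smul_mem _ (⟨c, hBO c.2⟩ : ↥(integralClosure ℤ K)) ht
    obtain ⟨u, hu⟩ := Submodule.mem_span_singleton.mp hlam
    obtain ⟨v, hv⟩ := Submodule.mem_span_singleton.mp hxlam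
    replace hu : (u : K) * x = lam' := hu
    replace hv : (v : K) * lam' = x := hv
    refine ⟨u, v, u.2, v.2, mul_right_cancel₀ hlam' ?_, ?_⟩
    · rw [mul_assoc, hv, hu, one_mul]
    · intro f hf
      obtain ⟨b, hb, h⟩ := coeff f hf
      have : (u : K) * algebraMap F K f * lam'⁻¹ = b := by
        rw [← h, mul_inv_eq_iff_eq_mul₀ hlam', ← hu]
        ring
      rwa [this]
  · rintro ⟨u, v, hu, hv, huv, hB⟩
    have hu0 : u ≠ 0 := left_ne_zero_of_mul_eq_one huv
    have hv0 : v ≠ 0 := right_ne_zero_of_mul_eq_one huv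
    have hfac : ∀ f : F, u * algebraMap F K f * lam'⁻¹ * (v * lam') = algebraMap F K f := by
      intro f
      calc u * algebraMap F K f * lam'⁻¹ * (v * lam')
          = (u * v) * algebraMap F K f * (lam'⁻¹ * lam') := by ring
        _ = _ := by rw [huv, inv_mul_cancel₀ hlam', one_mul, mul_one]
    have hy0 : v * lam' ≠ 0 := mul_ne_zero hv0 hlam'
    refine ⟨v * lam', hy0, le_antisymm ?_ ?_⟩
    · rw [Submodule.span_le]
      rintro _ ⟨f, hf, rfl⟩
      exact Submodule.mem_span_singleton.mpr ⟨⟨_, hB f hf⟩, hfac f⟩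
    · let I : Ideal ↥B := (Submodule.span ↥B
        (algebraMap F K '' ((a : Submodule ↥A F) : Set F))).comap
          (LinearMap.toSpanSingleton ↥B K (v * lam'))
      have hI : I = ⊤ := by
        refine eq_top_of_mem_span_integralClosure (Subalgebra.inclusion hBO).toRingHom
          (Subalgebra.inclusion_injective hBO) I hy0 ?_
          (Submodule.smul_mem _ (⟨v, hv⟩ : ↥(integralClosure ℤ K)) lam_mem)
        rintro _ ⟨f, hf, rfl⟩
        refine ⟨⟨_, hB f hf⟩, ?_, hfac f⟩
        change u * algebraMap F K f * lam'⁻¹ * (v * lam') ∈ Submodule.span ↥B _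
        rw [hfac]
        exact Submodule.subset_span ⟨f, hf, rfl⟩
      have h1 : (1 : ↥B) ∈ I := hI ▸ Submodule.mem_top
      rw [Submodule.span_singleton_le_iff_mem]
      simpa [I] using h1
  · rintro u v hu hv huv hB ⟨g, hg⟩
    have hinv : u⁻¹ = v := inv_eq_of_mul_eq_one_right huv
    rw [hinv] at hg
    have hv0 : v ≠ 0 := right_ne_zero_of_mul_eq_one huv
    have hy0 : algebraMap F K g ≠ 0 := hg ▸ mul_ne_zero hv0 hlam'
    have hg0 : g ≠ 0 := fun h => hy0 (by rw [h, map_zero])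
    have hA' : ∀ f ∈ ((a : Submodule ↥A F) : Set F), f * g⁻¹ ∈ A := by
      intro f hf
      rw [← hBproper]
      convert hB f hf using 1
      rw [map_mul, map_inv₀, hg, ← hinv, mul_inv, inv_inv]
      ring
    let φ : ↥A →+* ↥(integralClosure ℤ K) :=
      ((algebraMap F K).comp A.val.toRingHom).codRestrict (integralClosure ℤ K)
        fun x => hBO ((hBproper x).mpr x.2)
    have hφ : Function.Injective φ := fun x y h =>
      Subtype.ext ((algebraMap F K).injective (congrArg Subtype.val h))
    let I : Ideal ↥A := (a : Submodule ↥A F).comap (LinearMap.toSpanSingleton ↥A F g)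
    have hI : I = ⊤ := by
      refine eq_top_of_mem_span_integralClosure φ hφ I hy0 ?_ (hg.symm ▸ show v * lam' ∈ _ from
          Submodule.smul_mem _ (⟨v, hv⟩ : ↥(integralClosure ℤ K)) lam_mem)
      rintro _ ⟨f, hf, rfl⟩
      refine ⟨⟨_, hA' f hf⟩, ?_, ?_⟩
      · change f * g⁻¹ * g ∈ (a : Submodule ↥A F)
        rwa [inv_mul_cancel_right₀ hg0]
      · change algebraMap F K (f * g⁻¹) * algebraMap F K g = algebraMap F K f
        rw [← map_mul, inv_mul_cancel_right₀ hg0]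
    have h1 : (1 : ↥A) ∈ I := hI ▸ Submodule.mem_top
    refine hnp ⟨g, hg0, le_antisymm ?_ ?_⟩
    · intro f hf
      exact Submodule.mem_span_singleton.mpr
        ⟨⟨_, hA' f hf⟩, inv_mul_cancel_right₀ hg0 f⟩
    · rw [Submodule.span_singleton_le_iff_mem]
      simpa [I] using h1

end
end

section
/- Let F be a totally real number field, A a ℤ-order in F, and B a CM proper A-order that is stable under the nontrivial automorphism of its fraction field K over F (i.e. B = B̄). Then the kernel of i_{B/A}: Pic(A) → Pic(B) has at most 2 elements. -/
/-!
STATEMENT 9: Let `F` be a totally real number field, `A` a `ℤ`-order in `F`, and `B` a CM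
proper `A`-order that is stable under the nontrivial automorphism of its fraction field
`K` over `F` (i.e. `B = B̄`).  Then the kernel of `i_{B/A} : Pic(A) → Pic(B)` has at most
2 elements.

The kernel is realized as the set of classes in `Pic(A)` of those invertible
(= locally principal) fractional `A`-ideals whose extension to `B` is principal.
-/

noncomputable section
set_option synthInstance.maxHeartbeats 1000000
set_option maxHeartbeats 1000000

/-- Two units of finite order in a domain which are both squares or both non-squares differ by
the square of a unit of finite order. -/
theorem exists_sq_of_isSquare_iff {R : Type*} [CommRing R] [IsDomain R] {a b : Rˣ}
    (ha : IsOfFinOrder a) (hb : IsOfFinOrder b) (h : IsSquare a ↔ IsSquare b) :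
    ∃ w : Rˣ, IsOfFinOrder w ∧ a = b * w ^ 2 := by
  obtain ⟨w, hw⟩ : IsSquare (a / b) := by
    by_cases hsa : IsSquare a
    · exact hsa.div (h.1 hsa)
    · have hsb : ¬ IsSquare b := fun hb' => hsa (h.2 hb')
      have hpos : 0 < orderOf a * orderOf b := Nat.mul_pos ha.orderOf_pos hb.orderOf_pos
      have : NeZero (orderOf a * orderOf b) := ⟨hpos.ne'⟩
      obtain ⟨g, hg⟩ := IsCyclic.exists_generator (α := rootsOfUnity (orderOf a * orderOf b) R)
      have hma : a ∈ rootsOfUnity (orderOf a * orderOf b) R := by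
        rw [mem_rootsOfUnity, pow_mul, pow_orderOf_eq_one, one_pow]
      have hmb : b ∈ rootsOfUnity (orderOf a * orderOf b) R := by
        rw [mem_rootsOfUnity, mul_comm, pow_mul, pow_orderOf_eq_one, one_pow]
      obtain ⟨i, hi⟩ := Subgroup.mem_zpowers_iff.1 (hg ⟨a, hma⟩)
      obtain ⟨j, hj⟩ := Subgroup.mem_zpowers_iff.1 (hg ⟨b, hmb⟩)
      have hi' : (g : Rˣ) ^ i = a := by simpa using congrArg Subtype.val hi
      have hj' : (g : Rˣ) ^ j = b := by simpa using congrArg Subtype.val hj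
      have hio : ¬ Even i := fun he => hsa (hi' ▸ he.isSquare_zpow _)
      have hjo : ¬ Even j := fun he => hsb (hj' ▸ he.isSquare_zpow _)
      have hij : Even (i - j) := by
        rw [Int.even_sub]
        exact iff_of_false hio hjo
      have hq : a / b = (g : Rˣ) ^ (i - j) := by
        rw [zpow_sub, hi', hj', div_eq_mul_inv]
      rw [hq]
      exact hij.isSquare_zpow _
  have hw2 : w ^ 2 = a / b := by rw [hw, sq]
  refine ⟨w, ?_, by rw [hw2, mul_div_cancel]⟩
  refine IsOfFinOrder.of_pow (n := 2) ?_ (by norm_num)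
  rw [hw2, div_eq_mul_inv]
  exact (Commute.all a b⁻¹).isOfFinOrder_mul ha hb.inv

section CM

variable {F K : Type*} [Field F] [NumberField F] [Field K] [NumberField K] [Algebra F K]

/-- A quadratic extension has only two automorphisms. -/
theorem algEquiv_eq_refl_or_eq (hquad : Module.finrank F K = 2) {σ : K ≃ₐ[F] K}
    (hσ : σ ≠ AlgEquiv.refl) (τ : K ≃ₐ[F] K) : τ = AlgEquiv.refl ∨ τ = σ := by
  by_contra! hτ
  have : FiniteDimensional F K := Module.finite_of_finrank_pos (by omega)
  have hcard := AlgEquiv.card_le (F := F) (K := K)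
  have hlt : 2 < Fintype.card (K ≃ₐ[F] K) :=
    Fintype.two_lt_card_iff.2 ⟨τ, AlgEquiv.refl, σ, hτ.1, hτ.2, hσ.symm⟩
  rw [hquad] at hcard
  omega

theorem isGalois_of_finrank_eq_two (hquad : Module.finrank F K = 2) : IsGalois F K := by
  have : Algebra.IsQuadraticExtension F K := { finrank_eq_two' := hquad }
  infer_instance

/-- An element fixed by the nontrivial automorphism of a quadratic extension lies in the base. -/
theorem exists_algebraMap_eq_of_fixed (hquad : Module.finrank F K = 2) {σ : K ≃ₐ[F] K}
    (hσ : σ ≠ AlgEquiv.refl) {x : K} (hx : σ x = x) : ∃ c : F, algebraMap F K c = x := by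
  have := isGalois_of_finrank_eq_two hquad
  have : FiniteDimensional F K := Module.finite_of_finrank_pos (by omega)
  have hmem : x ∈ (⊥ : IntermediateField F K) := by
    rw [IsGalois.mem_bot_iff_fixed]
    intro τ
    rcases algEquiv_eq_refl_or_eq hquad hσ τ with rfl | rfl
    · rfl
    · exact hx
  exact IntermediateField.mem_bot.1 hmem

/-- In a CM extension, the nontrivial automorphism is complex conjugation under every complex
embedding. -/
theorem embedding_apply_eq_conj (hF : TotReal F) (hquad : Module.finrank F K = 2)
    (hCM : IsEmpty (K →+* ℝ)) {σ : K ≃ₐ[F] K} (hσ : σ ≠ AlgEquiv.refl) (φ : K →+* ℂ) (x : K) :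
    φ (σ x) = starRingEnd ℂ (φ x) := by
  have := isGalois_of_finrank_eq_two hquad
  have hreal := hF (φ.comp (algebraMap F K))
  obtain ⟨τ, hτ⟩ := NumberField.ComplexEmbedding.exists_comp_symm_eq_of_comp_eq (k := F) φ
    (NumberField.ComplexEmbedding.conjugate φ) (by
      ext y
      exact (RingHom.congr_fun (NumberField.ComplexEmbedding.isReal_iff.1 hreal) y).symm)
  rcases algEquiv_eq_refl_or_eq hquad hσ τ.symm with h | h
  · exfalso
    have hφ : NumberField.ComplexEmbedding.IsReal φ := by
      rw [NumberField.ComplexEmbedding.isReal_iff, ← hτ, h]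
      rfl
    exact hCM.false hφ.embedding
  · rw [h] at hτ
    exact RingHom.congr_fun hτ x

/-- In a CM extension, an integral element `b` with `b x = x̄` for some `x ≠ 0` is a root of
unity. -/
theorem exists_pow_eq_one_of_mul_eq_conj (hF : TotReal F) (hquad : Module.finrank F K = 2)
    (hCM : IsEmpty (K →+* ℝ)) {σ : K ≃ₐ[F] K} (hσ : σ ≠ AlgEquiv.refl) {b x : K}
    (hx : x ≠ 0) (hb : IsIntegral ℤ b) (hbx : b * x = σ x) : ∃ n : ℕ, 0 < n ∧ b ^ n = 1 := by
  obtain ⟨n, hn, h⟩ := NumberField.Embeddings.pow_eq_one_of_norm_eq_one K ℂ hb (by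
    intro φ
    have h := congrArg (fun z => ‖φ z‖) hbx
    simp only [map_mul, norm_mul, embedding_apply_eq_conj hF hquad hCM hσ, RCLike.norm_conj] at h
    exact mul_right_cancel₀ (by simpa using hx) (h.trans (one_mul _).symm))
  exact ⟨n, hn, h⟩

/-- Complex conjugation inverts roots of unity. -/
theorem conj_mul_eq_one_of_pow_eq_one (hF : TotReal F) (hquad : Module.finrank F K = 2)
    (hCM : IsEmpty (K →+* ℝ)) {σ : K ≃ₐ[F] K} (hσ : σ ≠ AlgEquiv.refl) {w : K} {n : ℕ}
    (hn : n ≠ 0) (hw : w ^ n = 1) : σ w * w = 1 := by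
  obtain ⟨φ⟩ : Nonempty (K →+* ℂ) := inferInstance
  apply φ.injective
  have hnorm : ‖φ w‖ = 1 := Complex.norm_eq_one_of_pow_eq_one (by rw [← map_pow, hw, map_one]) hn
  rw [map_mul, embedding_apply_eq_conj hF hquad hCM hσ, map_one, Complex.conj_mul', hnorm]
  simp

theorem conj_conj (hF : TotReal F) (hquad : Module.finrank F K = 2)
    (hCM : IsEmpty (K →+* ℝ)) {σ : K ≃ₐ[F] K} (hσ : σ ≠ AlgEquiv.refl) (x : K) :
    σ (σ x) = x := by
  obtain ⟨φ⟩ : Nonempty (K →+* ℂ) := inferInstance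
  apply φ.injective
  simp [embedding_apply_eq_conj hF hquad hCM hσ]

end CM

section Extension

variable {F K : Type*} [Field F] [Field K] [Algebra F K] {A : Subalgebra ℤ F} {B : Subalgebra ℤ K}

/-- If `u B ⊆ x B`, `y ∈ v B` and `x = c y` with `c` in the base field, then `c⁻¹ u ⊆ v`. -/
theorem span_inv_mul_le (hBproper : ∀ x : F, algebraMap F K x ∈ B ↔ x ∈ A)
    {u v : (Submodule ↥A F)ˣ} {x y : K} {c : F} (hc : c ≠ 0)
    (hu : Submodule.span ↥B (algebraMap F K '' ((u : Submodule ↥A F) : Set F)) ≤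
      Submodule.span ↥B {x})
    (hv : y ∈ Submodule.span ↥B (algebraMap F K '' ((v : Submodule ↥A F) : Set F)))
    (hxy : x = algebraMap F K c * y) :
    Submodule.span ↥A {c⁻¹} * (u : Submodule ↥A F) ≤ v := by
  have hle : Submodule.span ↥A {c⁻¹} * (u : Submodule ↥A F) *
      ((v⁻¹ : (Submodule ↥A F)ˣ) : Submodule ↥A F) ≤ 1 := by
    rw [Submodule.mul_le]
    intro m hm z hz
    obtain ⟨a, ha, rfl⟩ := Submodule.mem_span_singleton_mul.1 hm
    have hyz : y * algebraMap F K z ∈ B := by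
      clear hxy
      induction hv using Submodule.span_induction with
      | mem t ht =>
        obtain ⟨s, hs, rfl⟩ := ht
        rw [← map_mul, hBproper]
        have hsz := Submodule.mul_mem_mul hs hz
        rw [← Units.val_mul, mul_inv_cancel, Units.val_one] at hsz
        obtain ⟨r, hr⟩ := Submodule.mem_one.1 hsz
        rw [← hr]
        exact r.2
      | zero => simp
      | add s t _ _ hs ht => rw [add_mul]; exact add_mem hs ht
      | smul b t _ ht =>
        rw [Subalgebra.smul_def, smul_eq_mul, mul_assoc]
        exact mul_mem b.2 ht
    obtain ⟨b, hb⟩ := Submodule.mem_span_singleton.1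
      (hu (Submodule.subset_span (Set.mem_image_of_mem _ ha)))
    rw [Subalgebra.smul_def, smul_eq_mul] at hb
    have hcK : algebraMap F K c ≠ 0 := by simpa using hc
    have hmem : c⁻¹ * a * z ∈ A := by
      rw [← hBproper]
      have heq : algebraMap F K (c⁻¹ * a * z) = (b : K) * (y * algebraMap F K z) := by
        rw [map_mul, map_mul, ← hb, hxy, map_inv₀]
        field_simp
      rw [heq]
      exact mul_mem b.2 hyz
    exact Submodule.mem_one.2 ⟨⟨_, hmem⟩, rfl⟩
  calc Submodule.span ↥A {c⁻¹} * (u : Submodule ↥A F)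
      = Submodule.span ↥A {c⁻¹} * (u : Submodule ↥A F) *
        ((v⁻¹ : (Submodule ↥A F)ˣ) : Submodule ↥A F) * v := by
        rw [mul_assoc _ ((v⁻¹ : (Submodule ↥A F)ˣ) : Submodule ↥A F), ← Units.val_mul,
          inv_mul_cancel, Units.val_one, mul_one]
    _ ≤ 1 * (v : Submodule ↥A F) := mul_le_mul_left hle _
    _ = v := one_mul _

/-- If `u B = x B`, `v B = y B` and `x / y` lies in the base field, then `u` and `v` have the same
class. -/
theorem picCls_eq_of_eq_algebraMap_mul (hBproper : ∀ x : F, algebraMap F K x ∈ B ↔ x ∈ A)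
    {u v : (Submodule ↥A F)ˣ} {x y : K} {c : F} (hc : c ≠ 0)
    (hu : Submodule.span ↥B (algebraMap F K '' ((u : Submodule ↥A F) : Set F)) =
      Submodule.span ↥B {x})
    (hv : Submodule.span ↥B (algebraMap F K '' ((v : Submodule ↥A F) : Set F)) =
      Submodule.span ↥B {y})
    (hxy : x = algebraMap F K c * y) : picCls A u = picCls A v := by
  have hcK : algebraMap F K c ≠ 0 := by simpa using hc
  have h₁ := span_inv_mul_le hBproper hc hu.le
    (hv ▸ Submodule.mem_span_singleton_self y) hxy
  have h₂ := span_inv_mul_le hBproper (inv_ne_zero hc) hv.le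
    (hu ▸ Submodule.mem_span_singleton_self x)
    (show y = algebraMap F K c⁻¹ * x by rw [hxy, map_inv₀]; field_simp)
  have heq : (v : Submodule ↥A F) = Submodule.span ↥A {c⁻¹} * (u : Submodule ↥A F) := by
    refine le_antisymm ?_ h₁
    have h₃ := mul_le_mul_right h₂ (Submodule.span ↥A {c⁻¹})
    rwa [← mul_assoc, Submodule.span_mul_span, Set.singleton_mul_singleton, inv_inv,
      inv_mul_cancel₀ hc, ← Submodule.one_eq_span, one_mul] at h₃
  refine QuotientGroup.eq.2 ⟨c⁻¹, (inv_ne_zero hc).isUnit, ?_⟩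
  rw [Units.val_mul, heq, mul_comm (Submodule.span ↥A {c⁻¹}), ← mul_assoc, ← Units.val_mul,
    inv_mul_cancel, Units.val_one, one_mul]

/-- If `u B = x B` and `B` is stable under the involution `σ` over the base field, then
`σ x = β x` for a unit `β` of `B`. -/
theorem exists_unit_mul_eq_conj (σ : K ≃ₐ[F] K) (hσσ : ∀ x, σ (σ x) = x)
    (hstable : ∀ b ∈ B, σ b ∈ B) {s : Set F} {x : K} (hx : x ≠ 0)
    (hs : Submodule.span ↥B (algebraMap F K '' s) = Submodule.span ↥B {x}) :
    ∃ β : (↥B)ˣ, ((β : ↥B) : K) * x = σ x := by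
  have hmem : ∀ y ∈ Submodule.span ↥B (algebraMap F K '' s),
      σ y ∈ Submodule.span ↥B (algebraMap F K '' s) := by
    intro y hy
    induction hy using Submodule.span_induction with
    | mem t ht =>
      obtain ⟨r, hr, rfl⟩ := ht
      rw [AlgEquiv.commutes]
      exact Submodule.subset_span (Set.mem_image_of_mem _ hr)
    | zero => simp
    | add s t _ _ hs ht => rw [map_add]; exact add_mem hs ht
    | smul b t _ ht =>
      rw [Subalgebra.smul_def, smul_eq_mul, map_mul]
      exact Submodule.smul_mem _ (⟨σ b, hstable _ b.2⟩ : ↥B) ht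
  have hx' := hmem x (hs ▸ Submodule.mem_span_singleton_self x)
  rw [hs] at hx'
  obtain ⟨b, hb⟩ := Submodule.mem_span_singleton.1 hx'
  rw [Subalgebra.smul_def, smul_eq_mul] at hb
  have h1 : (b : K) * σ b = 1 := by
    have h := congrArg σ hb
    rw [hσσ, map_mul, ← hb] at h
    exact mul_right_cancel₀ hx (by linear_combination h)
  have h2 : b * ⟨σ b, hstable _ b.2⟩ = 1 := Subtype.ext h1
  exact ⟨Units.mkOfMulEqOne _ _ h2, hb⟩

end Extension

theorem card_ker_le_two_of_conj_stable
    {F : Type*} [Field F] [NumberField F] (hF : TotReal F)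
    {K : Type*} [Field K] [NumberField K] [Algebra F K]
    (hquad : Module.finrank F K = 2) (hCM : IsEmpty (K →+* ℝ))
    (A : Subalgebra ℤ F) (hA : IsZOrder A)
    (B : Subalgebra ℤ K) (hB : IsZOrder B)
    (hBproper : ∀ x : F, algebraMap F K x ∈ B ↔ x ∈ A)
    -- `B` is stable under the nontrivial `F`-automorphism of `K`
    (σ : K ≃ₐ[F] K) (hσ : σ ≠ AlgEquiv.refl)
    (hstable : B.map ((σ.toAlgHom.restrictScalars ℤ : K →ₐ[ℤ] K)) = B) :
    Nat.card ↥(picCls A ''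
      {u : (Submodule ↥A F)ˣ | ∃ x : K, x ≠ 0 ∧
        Submodule.span ↥B (algebraMap F K '' ((u : Submodule ↥A F) : Set F))
          = Submodule.span ↥B {x}}) ≤ 2 := by
  have hσσ := conj_conj hF hquad hCM hσ
  have hst : ∀ b ∈ B, σ b ∈ B := fun b hb => by
    rw [← hstable]
    exact ⟨b, hb, rfl⟩
  have hdata : ∀ t : ↥(picCls A ''
      {u : (Submodule ↥A F)ˣ | ∃ x : K, x ≠ 0 ∧
        Submodule.span ↥B (algebraMap F K '' ((u : Submodule ↥A F) : Set F))
          = Submodule.span ↥B {x}}), ∃ (u : (Submodule ↥A F)ˣ) (x : K) (β : (↥B)ˣ),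
      picCls A u = t ∧ x ≠ 0 ∧
      Submodule.span ↥B (algebraMap F K '' ((u : Submodule ↥A F) : Set F))
          = Submodule.span ↥B {x} ∧ ((β : ↥B) : K) * x = σ x ∧ IsOfFinOrder β := by
    rintro ⟨_, u, ⟨x, hx, hu⟩, rfl⟩
    obtain ⟨β, hβ⟩ := exists_unit_mul_eq_conj σ hσσ hst hx hu
    obtain ⟨n, hn, hpow⟩ := exists_pow_eq_one_of_mul_eq_conj hF hquad hCM hσ hx
      (IsIntegral.of_mem_of_fg B hB.1 _ (β : ↥B).2) hβ
    refine ⟨u, x, β, rfl, hx, hu, hβ, isOfFinOrder_iff_pow_eq_one.2 ⟨n, hn, ?_⟩⟩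
    exact Units.ext (Subtype.ext (by simpa using hpow))
  choose U X β hU hX hspan hβ hfin using hdata
  refine (Nat.card_le_card_of_injective (fun t => IsSquare (β t)) ?_).trans (by simp)
  intro t t' htt
  obtain ⟨w, hw, hww⟩ := exists_sq_of_isSquare_iff (hfin t) (hfin t') (iff_of_eq htt)
  obtain ⟨n, hn, hpow⟩ := isOfFinOrder_iff_pow_eq_one.1 hw
  have hσw : σ ((w : ↥B) : K) * ((w : ↥B) : K) = 1 :=
    conj_mul_eq_one_of_pow_eq_one hF hquad hCM hσ hn.ne'
      (by simpa using congrArg (fun z : (↥B)ˣ => ((z : ↥B) : K)) hpow)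
  have hw0 : ((w : ↥B) : K) ≠ 0 := right_ne_zero_of_mul_eq_one hσw
  have hww' : ((β t : ↥B) : K) = (β t' : ↥B) * ((w : ↥B) : K) ^ 2 := by
    simpa using congrArg (fun z : (↥B)ˣ => ((z : ↥B) : K)) hww
  have hβ0 : ((β t' : ↥B) : K) ≠ 0 := fun h => by
    have h' := hβ t'
    rw [h, zero_mul, eq_comm, map_eq_zero_iff σ σ.injective] at h'
    exact hX t' h'
  have hfix : σ (X t / X t' * ((w : ↥B) : K)) = X t / X t' * ((w : ↥B) : K) := by
    rw [map_mul, map_div₀, ← hβ, ← hβ, hww', eq_inv_of_mul_eq_one_left hσw]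
    have := hX t'
    field_simp
  obtain ⟨c, hc⟩ := exists_algebraMap_eq_of_fixed hquad hσ hfix
  have hc0 : c ≠ 0 := by
    rintro rfl
    rw [map_zero] at hc
    exact mul_ne_zero (div_ne_zero (hX t) (hX t')) hw0 hc.symm
  refine Subtype.ext ?_
  rw [← hU t, ← hU t']
  refine picCls_eq_of_eq_algebraMap_mul (y := ((w⁻¹ : (↥B)ˣ) : ↥B) • X t') hBproper hc0
    (hspan t) ?_ ?_
  · rw [hspan t']
    exact (Submodule.span_singleton_group_smul_eq ↥B w⁻¹ (X t')).symm
  · have hwi : (((w⁻¹ : (↥B)ˣ) : ↥B) : K) = ((w : ↥B) : K)⁻¹ :=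
      eq_inv_of_mul_eq_one_left
        (by rw [← Subalgebra.coe_mul, ← Units.val_mul, inv_mul_cancel]; rfl)
    rw [Subalgebra.smul_def, smul_eq_mul, hwi, hc]
    have := hX t'
    field_simp

end
end

section
/- Let F be a totally real number field and [a] a nontrivial ideal class in Pic(O_F). Then there exists a CM O_F-order B with [a] ∈ ker(i_{B/O_F}) if and only if [a] ∈ C₂(F), i.e. a² = τO_F for some totally positive τ ∈ F^× (after replacing a by an ideal in its class). In particular, if a is a non-principal fractional O_F-ideal with a² = τO_F for a totally positive τ, then a becomes principal in the ring of integers of the CM extension K = F(√−τ). Consequently, 𝓑 is the disjoint union of the sets 𝓑_{[a]} over the nontrivial classes [a] ∈ C₂(F). -/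
/-!
STATEMENT 10: Let `F` be a totally real number field and `[a]` a nontrivial ideal class in
`Pic(O_F)`.  Then there exists a CM `O_F`-order `B` with `[a] ∈ ker (i_{B/O_F})` if and
only if `[a] ∈ C₂(F)`, i.e. `a² = τ O_F` for some totally positive `τ ∈ F^×`.
In particular, if `a` is a non-principal fractional `O_F`-ideal with `a² = τ O_F` for a
totally positive `τ`, then `a` becomes principal in the ring of integers of the CM
extension `K = F(√−τ)`.  Consequently, `𝓑` is the disjoint union of the sets `𝓑_{[a]}`
over the nontrivial classes `[a] ∈ C₂(F)` (each `B ∈ 𝓑` lies in `𝓑_{[a]}` for exactly one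
nontrivial class `[a]`, and this class lies in `C₂(F)`).

Here `O_F = integralClosure ℤ F`, CM `O_F`-orders are realized inside a fixed algebraic
closure `Ω` of `F` (with `K = F(√−τ)` realized as `F[s]` for `s ∈ Ω` with `s² = −τ`),
capitulation of `[a]` in `B` means the extension `aB` is principal, and `C₂(F)` is the
image in `Pic(O_F)` of the 2-torsion of the narrow class group — equivalently (used here)
`a·a` is generated by a totally positive element.
-/

noncomputable section
set_option synthInstance.maxHeartbeats 1000000
set_option maxHeartbeats 1000000

section Conjugation

variable {F : Type*} [Field F] {K : Type*} [Field K] [Algebra F K]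

/-- A totally imaginary quadratic extension `K` of a totally real field `F` has an
`F`-automorphism inducing complex conjugation under every complex embedding of `K`, and whose
fixed field is `F`. -/
theorem TotReal.exists_conj [NumberField F] (hF : TotReal F) (h2 : Module.finrank F K = 2)
    (him : IsEmpty (K →+* ℝ)) :
    ∃ σ : K ≃ₐ[F] K, (∀ (φ : K →+* ℂ) (x : K), φ (σ x) = starRingEnd ℂ (φ x)) ∧
      ∀ x : K, σ x = x → ∃ y : F, algebraMap F K y = x := by
  have hfin : Module.Finite F K := Module.finite_of_finrank_pos (by omega)
  have : NumberField K := NumberField.of_module_finite F K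
  have : Algebra.IsQuadraticExtension F K := ⟨h2⟩
  have key : ∀ φ : K →+* ℂ, ∃ σ : K ≃ₐ[F] K,
      NumberField.ComplexEmbedding.IsConj φ σ ∧ σ ≠ 1 := by
    intro φ
    obtain ⟨σ, hσ⟩ := NumberField.ComplexEmbedding.exists_comp_symm_eq_of_comp_eq (k := F) φ
      (NumberField.ComplexEmbedding.conjugate φ) (hF (φ.comp (algebraMap F K))).symm
    have hc : NumberField.ComplexEmbedding.IsConj φ σ.symm := hσ.symm
    refine ⟨σ.symm, hc, (NumberField.ComplexEmbedding.isConj_ne_one_iff hc).2 fun hr => ?_⟩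
    exact him.false hr.embedding
  have hcard : Nat.card (K ≃ₐ[F] K) = 2 := by rw [IsGalois.card_aut_eq_finrank, h2]
  obtain ⟨τ, hτ, huniq⟩ := (Nat.card_eq_two_iff' (1 : K ≃ₐ[F] K)).1 hcard
  refine ⟨τ, fun φ x => ?_, fun x hx => ?_⟩
  · obtain ⟨σ, hc, hσ⟩ := key φ
    rw [← huniq σ hσ]
    exact hc.eq x
  · refine (IsGalois.mem_range_algebraMap_iff_fixed x).2 fun f => ?_
    by_cases hf : f = 1
    · simp [hf]
    · rw [huniq f hf, hx]

theorem totPos_of_algebraMap_eq_mul_conj [Algebra.IsAlgebraic F K] {σ : K ≃ₐ[F] K}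
    (hσ : ∀ (φ : K →+* ℂ) (x : K), φ (σ x) = starRingEnd ℂ (φ x)) {x : K} (hx : x ≠ 0) {τ : F}
    (hτ : algebraMap F K τ = x * σ x) : TotPos τ := by
  intro ρ
  let : Algebra F ℂ := (Complex.ofRealHom.comp ρ).toAlgebra
  let φ : K →ₐ[F] ℂ := IsAlgClosed.lift
  have h1 : φ (algebraMap F K τ) = (ρ τ : ℂ) := φ.commutes τ
  have h2 : φ (σ x) = starRingEnd ℂ (φ x) := hσ φ.toRingHom x
  rw [hτ, map_mul, h2, Complex.mul_conj] at h1
  have h3 : Complex.normSq (φ x) = ρ τ := by exact_mod_cast h1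
  rw [← h3]
  exact Complex.normSq_pos.2 ((map_ne_zero φ).2 hx)

/-- Among two roots of unity, one of them or their product is the square of a root of unity. -/
theorem isSquare_rootOfUnity_or {ζ ξ : K} {m n : ℕ} (hm : 0 < m) (hn : 0 < n)
    (hζ : ζ ^ m = 1) (hξ : ξ ^ n = 1) :
    ∃ (η : K) (k : ℕ), 0 < k ∧ η ^ k = 1 ∧ (ζ = η ^ 2 ∨ ξ = η ^ 2 ∨ ζ * ξ = η ^ 2) := by
  have hmn : 0 < m * n := Nat.mul_pos hm hn
  have : NeZero (m * n) := ⟨hmn.ne'⟩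
  let z : rootsOfUnity (m * n) K := rootsOfUnity.mkOfPowEq ζ (by rw [pow_mul, hζ, one_pow])
  let x : rootsOfUnity (m * n) K := rootsOfUnity.mkOfPowEq ξ (by rw [mul_comm, pow_mul, hξ, one_pow])
  have hz : ((z : Kˣ) : K) = ζ := rfl
  have hx : ((x : Kˣ) : K) = ξ := rfl
  obtain ⟨g, hg⟩ := IsCyclic.exists_generator (α := rootsOfUnity (m * n) K)
  obtain ⟨i, hi⟩ := Subgroup.mem_zpowers_iff.1 (hg z)
  obtain ⟨j, hj⟩ := Subgroup.mem_zpowers_iff.1 (hg x)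
  have tor : ∀ h : rootsOfUnity (m * n) K, ((h : Kˣ) : K) ^ (m * n) = 1 := fun h => by
    have := congrArg Units.val ((mem_rootsOfUnity _ _).1 h.2)
    rwa [Units.val_pow_eq_pow_val, Units.val_one] at this
  have sq : ∀ (w : rootsOfUnity (m * n) K) (l : ℤ), g ^ (l + l) = w →
      ((w : Kˣ) : K) = (((g ^ l : rootsOfUnity (m * n) K) : Kˣ) : K) ^ 2 := by
    rintro w l rfl
    rw [zpow_add, pow_two]
    simp
  rcases Int.even_or_odd' i with ⟨i', rfl | hi'⟩
  · exact ⟨_, _, hmn, tor (g ^ i'), Or.inl (sq z i' (by rw [← two_mul, hi]))⟩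
  rcases Int.even_or_odd' j with ⟨j', rfl | hj'⟩
  · exact ⟨_, _, hmn, tor (g ^ j'), Or.inr (Or.inl (sq x j' (by rw [← two_mul, hj])))⟩
  · refine ⟨_, _, hmn, tor (g ^ (i' + j' + 1)), Or.inr (Or.inr ?_)⟩
    rw [← sq (z * x) (i' + j' + 1) (by rw [← hi, ← hj, ← zpow_add, hi', hj']; ring_nf)]
    simp [hz, hx]

end Conjugation

section Generators

variable {F : Type*} [Field F] {L : Type*} [Field L] [Algebra F L]

/-- The extension of the invertible fractional ideal `a` to the integral closure of `ℤ` in `L`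
is generated by `x`. -/
def GeneratesInIntegers (a : (Submodule ↥(integralClosure ℤ F) F)ˣ) (x : L) : Prop :=
  (∀ y ∈ (a : Submodule ↥(integralClosure ℤ F) F), IsIntegral ℤ (algebraMap F L y * x⁻¹)) ∧
    ∀ z ∈ ((a⁻¹ : (Submodule ↥(integralClosure ℤ F) F)ˣ) : Submodule ↥(integralClosure ℤ F) F),
      IsIntegral ℤ (algebraMap F L z * x)

variable {a b : (Submodule ↥(integralClosure ℤ F) F)ˣ} {x y : L}

theorem isIntegral_algebraMap_mul_of_mem_mul {I J : Submodule ↥(integralClosure ℤ F) F} {u v : L}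
    (hI : ∀ t ∈ I, IsIntegral ℤ (algebraMap F L t * u))
    (hJ : ∀ t ∈ J, IsIntegral ℤ (algebraMap F L t * v)) {t : F} (ht : t ∈ I * J) :
    IsIntegral ℤ (algebraMap F L t * (u * v)) := by
  induction ht using Submodule.mul_induction_on' with
  | mem_mul_mem p hp q hq =>
    rw [map_mul, mul_mul_mul_comm]
    exact (hI p hp).mul (hJ q hq)
  | add p hp q hq hp' hq' =>
    rw [map_add, add_mul]
    exact hp'.add hq'

theorem one_mem_inv_mul (a : (Submodule ↥(integralClosure ℤ F) F)ˣ) :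
    (1 : F) ∈ ((a⁻¹ : (Submodule ↥(integralClosure ℤ F) F)ˣ) :
      Submodule ↥(integralClosure ℤ F) F) * (a : Submodule ↥(integralClosure ℤ F) F) := by
  rw [← Units.val_mul, inv_mul_cancel, Units.val_one]
  exact Submodule.one_le.1 le_rfl

theorem GeneratesInIntegers.mul (hx : GeneratesInIntegers a x) (hy : GeneratesInIntegers b y) :
    GeneratesInIntegers (a * b) (x * y) := by
  refine ⟨?_, ?_⟩
  · rw [mul_inv, Units.val_mul]
    exact fun t ht => isIntegral_algebraMap_mul_of_mem_mul hx.1 hy.1 ht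
  · rw [mul_inv, Units.val_mul]
    exact fun t ht => isIntegral_algebraMap_mul_of_mem_mul hx.2 hy.2 ht

theorem GeneratesInIntegers.map {M : Type*} [Field M] [Algebra F M] (f : L →ₐ[F] M)
    (hx : GeneratesInIntegers a x) : GeneratesInIntegers a (f x) := by
  refine ⟨fun t ht => ?_, fun t ht => ?_⟩
  · simpa using map_isIntegral_int f.toRingHom (hx.1 t ht)
  · simpa using map_isIntegral_int f.toRingHom (hx.2 t ht)

theorem GeneratesInIntegers.of_map {M : Type*} [Field M] [Algebra F M] (f : L →ₐ[F] M)
    (hx : GeneratesInIntegers a (f x)) : GeneratesInIntegers a x := by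
  have aux : ∀ u : L, IsIntegral ℤ (f u) → IsIntegral ℤ u := fun u hu =>
    (isIntegral_algHom_iff (f.restrictScalars ℤ) f.injective).1 hu
  refine ⟨fun t ht => aux _ ?_, fun t ht => aux _ ?_⟩
  · simpa using hx.1 t ht
  · simpa using hx.2 t ht

theorem GeneratesInIntegers.mul_rootOfUnity (hx : GeneratesInIntegers a x) {η : L} {k : ℕ}
    (hk : 0 < k) (hη : η ^ k = 1) : GeneratesInIntegers a (x * η) := by
  have aux : ∀ u : L, u ^ k = 1 → IsIntegral ℤ u := fun u hu =>
    IsIntegral.of_pow hk (hu ▸ isIntegral_one)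
  refine ⟨fun t ht => ?_, fun t ht => ?_⟩
  · rw [mul_inv, ← mul_assoc]
    exact (hx.1 t ht).mul (aux _ (by rw [inv_pow, hη, inv_one]))
  · rw [← mul_assoc]
    exact (hx.2 t ht).mul (aux _ hη)

theorem GeneratesInIntegers.eq_span {τ : F} (hτ : τ ≠ 0)
    (h : GeneratesInIntegers a (algebraMap F L τ)) :
    (a : Submodule ↥(integralClosure ℤ F) F) = Submodule.span ↥(integralClosure ℤ F) {τ} := by
  have h := GeneratesInIntegers.of_map (x := τ) (Algebra.ofId F L) h
  apply le_antisymm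
  · intro t ht
    refine Submodule.mem_span_singleton.2 ⟨⟨t * τ⁻¹, h.1 t ht⟩, ?_⟩
    change t * τ⁻¹ * τ = t
    rw [inv_mul_cancel_right₀ hτ]
  · rw [Submodule.span_singleton_le_iff_mem]
    have aux : ∀ t ∈ ((a⁻¹ : (Submodule ↥(integralClosure ℤ F) F)ˣ) :
        Submodule ↥(integralClosure ℤ F) F) * (a : Submodule ↥(integralClosure ℤ F) F),
        t * τ ∈ (a : Submodule ↥(integralClosure ℤ F) F) := by
      intro t ht
      induction ht using Submodule.mul_induction_on' with
      | mem_mul_mem p hp q hq =>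
        have := Submodule.smul_mem _ (⟨p * τ, h.2 p hp⟩ : ↥(integralClosure ℤ F)) hq
        convert this using 1
        change _ = p * τ * q
        ring
      | add p hp q hq hp' hq' =>
        rw [add_mul]
        exact add_mem hp' hq'
    simpa using aux 1 (one_mem_inv_mul a)

/-- An equality of extended ideals `aB = xB` over a ring `B` of algebraic integers persists over
the ring of all algebraic integers. -/
theorem GeneratesInIntegers.of_capitulation {B : Subalgebra ℤ (AlgebraicClosure F)}
    (hB : ∀ t ∈ B, IsIntegral ℤ t) {x : AlgebraicClosure F} (hx : x ≠ 0)
    (h : extIdeal B (a : Submodule ↥(integralClosure ℤ F) F) = Submodule.span ↥B {x}) :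
    GeneratesInIntegers a x := by
  refine ⟨fun t ht => ?_, fun z hz => ?_⟩
  · have h1 : algebraMap F (AlgebraicClosure F) t ∈ Submodule.span ↥B {x} :=
      h ▸ Submodule.subset_span ⟨t, ht, rfl⟩
    obtain ⟨c, hc⟩ := Submodule.mem_span_singleton.1 h1
    have hc : (c : AlgebraicClosure F) * x = algebraMap F (AlgebraicClosure F) t := hc
    rw [← hc, mul_inv_cancel_right₀ hx]
    exact hB _ c.2
  · have h1 : x ∈ extIdeal B (a : Submodule ↥(integralClosure ℤ F) F) :=
      h ▸ Submodule.mem_span_singleton_self x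
    unfold extIdeal at h1
    clear h hx
    induction h1 using Submodule.span_induction with
    | mem u hu =>
      obtain ⟨t, ht, rfl⟩ := hu
      rw [← map_mul]
      have h2 : z * t ∈ ((a⁻¹ * a : (Submodule ↥(integralClosure ℤ F) F)ˣ) :
          Submodule ↥(integralClosure ℤ F) F) := by
        rw [Units.val_mul]
        exact Submodule.mul_mem_mul hz ht
      rw [inv_mul_cancel, Units.val_one] at h2
      obtain ⟨c, hc⟩ := Submodule.mem_one.1 h2
      rw [← hc]
      exact map_isIntegral_int (algebraMap F (AlgebraicClosure F)) c.2
    | zero => rw [mul_zero]; exact isIntegral_zero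
    | add u v _ _ hu hv => rw [mul_add]; exact hu.add hv
    | smul c u _ hu =>
      change IsIntegral ℤ (_ * ((c : AlgebraicClosure F) * u))
      rw [mul_left_comm]
      exact (hB _ c.2).mul hu

theorem mem_adjoin_of_extIdeal_eq_span {A : Subalgebra ℤ F} {I : Submodule ↥A F}
    {B : Subalgebra ℤ (AlgebraicClosure F)} {x : AlgebraicClosure F}
    (h : extIdeal B I = Submodule.span ↥B {x}) :
    x ∈ Algebra.adjoin F (B : Set (AlgebraicClosure F)) := by
  have h1 : x ∈ extIdeal B I := h ▸ Submodule.mem_span_singleton_self x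
  unfold extIdeal at h1
  clear h
  induction h1 using Submodule.span_induction with
  | mem u hu =>
    obtain ⟨t, ht, rfl⟩ := hu
    exact Subalgebra.algebraMap_mem _ _
  | zero => exact zero_mem _
  | add u v _ _ hu hv => exact add_mem hu hv
  | smul c u _ hu => exact mul_mem (Algebra.subset_adjoin c.2) hu

end Generators

section CMExtension

variable {F : Type*} [Field F] [NumberField F] {K : Type*} [Field K] [Algebra F K]
  {a b : (Submodule ↥(integralClosure ℤ F) F)ˣ} {x y : K}

theorem GeneratesInIntegers.exists_totPos_sq (hF : TotReal F) (h2 : Module.finrank F K = 2)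
    (him : IsEmpty (K →+* ℝ)) (hx0 : x ≠ 0) (hx : GeneratesInIntegers a x) :
    ∃ τ : F, τ ≠ 0 ∧ TotPos τ ∧ ((a * a : (Submodule ↥(integralClosure ℤ F) F)ˣ) :
      Submodule ↥(integralClosure ℤ F) F) = Submodule.span ↥(integralClosure ℤ F) {τ} := by
  have hfin : Module.Finite F K := Module.finite_of_finrank_pos (by omega)
  have : NumberField K := NumberField.of_module_finite F K
  obtain ⟨σ, hσ, hfix⟩ := hF.exists_conj h2 him
  obtain ⟨φ⟩ : Nonempty (K →+* ℂ) := inferInstance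
  obtain ⟨τ, hτ⟩ := hfix (x * σ x) (φ.injective (by simp [hσ, mul_comm]))
  have hτ0 : τ ≠ 0 := by
    rintro rfl
    rw [map_zero] at hτ
    exact mul_ne_zero hx0 ((map_ne_zero σ).2 hx0) hτ.symm
  refine ⟨τ, hτ0, totPos_of_algebraMap_eq_mul_conj hσ hx0 hτ, ?_⟩
  apply GeneratesInIntegers.eq_span (L := K) hτ0
  rw [hτ]
  exact hx.mul (hx.map (σ : K →ₐ[F] K))

/-- Of two ideals that become principal in a CM extension, one of them or their product is
already principal. -/
theorem GeneratesInIntegers.isPrincipalIdl_or (hF : TotReal F) (h2 : Module.finrank F K = 2)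
    (him : IsEmpty (K →+* ℝ)) (hx0 : x ≠ 0) (hx : GeneratesInIntegers a x)
    (hy0 : y ≠ 0) (hy : GeneratesInIntegers b y) :
    IsPrincipalIdl (integralClosure ℤ F) (a : Submodule ↥(integralClosure ℤ F) F) ∨
    IsPrincipalIdl (integralClosure ℤ F) (b : Submodule ↥(integralClosure ℤ F) F) ∨
    IsPrincipalIdl (integralClosure ℤ F) ((a * b : (Submodule ↥(integralClosure ℤ F) F)ˣ) :
      Submodule ↥(integralClosure ℤ F) F) := by
  have hfin : Module.Finite F K := Module.finite_of_finrank_pos (by omega)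
  have : NumberField K := NumberField.of_module_finite F K
  obtain ⟨σ, hσ, hfix⟩ := hF.exists_conj h2 him
  have unity : ∀ (c : (Submodule ↥(integralClosure ℤ F) F)ˣ) (u : K), u ≠ 0 →
      GeneratesInIntegers c u → ∃ m : ℕ, 0 < m ∧ (u * (σ u)⁻¹) ^ m = 1 := by
    intro c u hu0 hu
    have hint : IsIntegral ℤ (u * (σ u)⁻¹) := by
      have := isIntegral_algebraMap_mul_of_mem_mul hu.2 (hu.map (σ : K →ₐ[F] K)).1
        (one_mem_inv_mul c)
      rwa [map_one, one_mul] at this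
    obtain ⟨m, hm, h⟩ := NumberField.Embeddings.pow_eq_one_of_norm_eq_one K ℂ hint (fun φ => by
      rw [map_mul, map_inv₀, hσ, norm_mul, norm_inv, RCLike.norm_conj]
      exact mul_inv_cancel₀ (norm_ne_zero_iff.2 ((map_ne_zero φ).2 hu0)))
    exact ⟨m, hm, h⟩
  have descend : ∀ (c : (Submodule ↥(integralClosure ℤ F) F)ˣ) (u : K), u ≠ 0 →
      GeneratesInIntegers c u → ∀ (η : K) (k : ℕ), 0 < k → η ^ k = 1 →
      u * (σ u)⁻¹ = η ^ 2 →
      IsPrincipalIdl (integralClosure ℤ F) (c : Submodule ↥(integralClosure ℤ F) F) := by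
    intro c u hu0 hu η k hk hη hsq
    have hη0 : η ≠ 0 := by
      rintro rfl
      rw [zero_pow hk.ne'] at hη
      exact zero_ne_one hη
    have hση : σ η = η⁻¹ := by
      obtain ⟨φ⟩ : Nonempty (K →+* ℂ) := inferInstance
      apply φ.injective
      rw [hσ, map_inv₀, Complex.inv_eq_conj]
      exact Complex.norm_eq_one_of_pow_eq_one (by rw [← map_pow, hη, map_one]) hk.ne'
    have hσu : σ u ≠ 0 := (map_ne_zero σ).2 hu0
    obtain ⟨t, ht⟩ := hfix (u * η⁻¹) (by
      rw [map_mul, map_inv₀, hση, inv_inv]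
      rw [eq_mul_inv_iff_mul_eq₀ hη0]
      linear_combination -(mul_inv_eq_iff_eq_mul₀ hσu).1 hsq)
    have ht0 : t ≠ 0 := by
      rintro rfl
      rw [map_zero] at ht
      exact mul_ne_zero hu0 (inv_ne_zero hη0) ht.symm
    exact ⟨t, ht0, GeneratesInIntegers.eq_span (L := K) ht0
      (ht ▸ hu.mul_rootOfUnity hk (by rw [inv_pow, hη, inv_one]))⟩
  obtain ⟨m, hm, hζ⟩ := unity a x hx0 hx
  obtain ⟨n, hn, hξ⟩ := unity b y hy0 hy
  obtain ⟨η, k, hk, hη, h | h | h⟩ := isSquare_rootOfUnity_or hm hn hζ hξ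
  · exact Or.inl (descend a x hx0 hx η k hk hη h)
  · exact Or.inr (Or.inl (descend b y hy0 hy η k hk hη h))
  · refine Or.inr (Or.inr (descend (a * b) (x * y) (mul_ne_zero hx0 hy0) (hx.mul hy) η k hk hη ?_))
    rw [← h, map_mul, mul_inv, mul_mul_mul_comm]

end CMExtension

section Picard

variable {F : Type*} [Field F]

theorem picCls_eq_one_iff {A : Subalgebra ℤ F} {u : (Submodule ↥A F)ˣ} :
    picCls A u = 1 ↔ IsPrincipalIdl A (u : Submodule ↥A F) := by
  refine (QuotientGroup.eq_one_iff (N := principalSub A) u).trans ?_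
  exact exists_congr fun x => and_congr_left' isUnit_iff_ne_zero

theorem picCls_mul {A : Subalgebra ℤ F} (u v : (Submodule ↥A F)ˣ) :
    picCls A (u * v) = picCls A u * picCls A v := rfl

end Picard

section SquareRoots

variable {F : Type*} [Field F]

theorem finrank_adjoin_sqrt {τ : F} {s : AlgebraicClosure F}
    (hs : s ^ 2 = algebraMap F (AlgebraicClosure F) τ) (hτ : ¬ IsSquare τ) :
    Module.finrank F (Algebra.adjoin F {s}) = 2 := by
  have hint : IsIntegral F s := Algebra.IsIntegral.isIntegral s
  rw [(Algebra.adjoin.powerBasis' hint).finrank, Algebra.adjoin.powerBasis'_dim]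
  apply le_antisymm
  · have h := minpoly.min F s (Polynomial.monic_X_pow_sub_C τ two_ne_zero) (by simp [hs])
    simpa only [Polynomial.natDegree_X_pow_sub_C] using Polynomial.natDegree_le_natDegree h
  · rw [minpoly.two_le_natDegree_iff hint]
    rintro ⟨r, rfl⟩
    refine hτ ⟨r, (algebraMap F (AlgebraicClosure F)).injective ?_⟩
    rw [← hs]
    simp [pow_two]

theorem isEmpty_ringHom_real {τ : F} (hτ : TotPos τ) {s : AlgebraicClosure F}
    (hs : s ^ 2 = algebraMap F (AlgebraicClosure F) (-τ))
    (S : Subalgebra F (AlgebraicClosure F)) (hS : s ∈ S) : IsEmpty (S →+* ℝ) := by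
  refine ⟨fun ρ => ?_⟩
  have h1 : (⟨s, hS⟩ : S) ^ 2 = algebraMap F S (-τ) := Subtype.ext hs
  have h2 := congrArg ρ h1
  have h3 := hτ (ρ.comp (algebraMap F S))
  rw [map_pow, map_neg, map_neg] at h2
  have h4 := sq_nonneg (ρ ⟨s, hS⟩)
  rw [h2] at h4
  simp only [RingHom.comp_apply] at h3
  linarith

end SquareRoots

section Orders

variable {F : Type*} [Field F] [NumberField F]

theorem CMOrder.exists_intermediateField {A : Subalgebra ℤ F} (C : CMOrder A) :
    ∃ K : IntermediateField F (AlgebraicClosure F), Module.finrank F K = 2 ∧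
      IsEmpty (K →+* ℝ) ∧
      ∀ x ∈ Algebra.adjoin F (C.B : Set (AlgebraicClosure F)), x ∈ K := by
  have hK : (IntermediateField.adjoin F (C.B : Set (AlgebraicClosure F))).toSubalgebra =
      Algebra.adjoin F (C.B : Set (AlgebraicClosure F)) :=
    IntermediateField.adjoin_toSubalgebra_of_isAlgebraic fun x _ =>
      Algebra.IsAlgebraic.isAlgebraic x
  refine ⟨IntermediateField.adjoin F (C.B : Set (AlgebraicClosure F)), ?_, ?_, ?_⟩
  · have := C.quadratic
    rw [← hK] at this
    exact this
  · have := C.imaginary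
    rw [← hK] at this
    exact this
  · rw [← hK]
    exact fun x hx => hx

theorem GeneratesInIntegers.of_CMOrder {C : CMOrder (integralClosure ℤ F)}
    {K : IntermediateField F (AlgebraicClosure F)}
    (hK : ∀ x ∈ Algebra.adjoin F (C.B : Set (AlgebraicClosure F)), x ∈ K)
    {u : (Submodule ↥(integralClosure ℤ F) F)ˣ}
    (hu : Capitulates C.B (u : Submodule ↥(integralClosure ℤ F) F)) :
    ∃ x : K, x ≠ 0 ∧ GeneratesInIntegers u x := by
  obtain ⟨x, hx0, hx⟩ := hu
  refine ⟨⟨x, hK x (mem_adjoin_of_extIdeal_eq_span hx)⟩, fun h => hx0 (congrArg Subtype.val h),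
    GeneratesInIntegers.of_map K.val ?_⟩
  exact GeneratesInIntegers.of_capitulation
    (fun t ht => IsIntegral.of_mem_of_fg C.B C.fg t ht) hx0 hx

theorem Capitulates.exists_totPos_sq (hF : TotReal F) {C : CMOrder (integralClosure ℤ F)}
    {u : (Submodule ↥(integralClosure ℤ F) F)ˣ}
    (hu : Capitulates C.B (u : Submodule ↥(integralClosure ℤ F) F)) :
    ∃ τ : F, τ ≠ 0 ∧ TotPos τ ∧ ((u * u : (Submodule ↥(integralClosure ℤ F) F)ˣ) :
      Submodule ↥(integralClosure ℤ F) F) = Submodule.span ↥(integralClosure ℤ F) {τ} := by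
  obtain ⟨K, h2, him, hK⟩ := C.exists_intermediateField
  obtain ⟨x, hx0, hx⟩ := GeneratesInIntegers.of_CMOrder hK hu
  exact hx.exists_totPos_sq hF h2 him hx0

theorem picCls_eq_of_capitulates (hF : TotReal F) {C : CMOrder (integralClosure ℤ F)}
    {u v : (Submodule ↥(integralClosure ℤ F) F)ˣ}
    (hu : Capitulates C.B (u : Submodule ↥(integralClosure ℤ F) F))
    (hv : Capitulates C.B (v : Submodule ↥(integralClosure ℤ F) F))
    (hu1 : picCls (integralClosure ℤ F) u ≠ 1) (hv1 : picCls (integralClosure ℤ F) v ≠ 1) :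
    picCls (integralClosure ℤ F) u = picCls (integralClosure ℤ F) v := by
  obtain ⟨K, h2, him, hK⟩ := C.exists_intermediateField
  obtain ⟨x, hx0, hx⟩ := GeneratesInIntegers.of_CMOrder hK hu
  obtain ⟨y, hy0, hy⟩ := GeneratesInIntegers.of_CMOrder hK hv
  obtain ⟨τ, hτ0, -, hτ⟩ := hv.exists_totPos_sq hF
  have hvv : picCls (integralClosure ℤ F) v * picCls (integralClosure ℤ F) v = 1 := by
    rw [← picCls_mul]
    exact picCls_eq_one_iff.2 ⟨τ, hτ0, hτ⟩
  rcases hx.isPrincipalIdl_or hF h2 him hx0 hy0 hy with h | h | h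
  · exact absurd (picCls_eq_one_iff.2 h) hu1
  · exact absurd (picCls_eq_one_iff.2 h) hv1
  · have huv := picCls_eq_one_iff.2 h
    rw [picCls_mul] at huv
    exact mul_right_cancel (huv.trans hvv.symm)

theorem TotPos.ne_zero (hF : TotReal F) {τ : F} (hτ : TotPos τ) : τ ≠ 0 := by
  rintro rfl
  obtain ⟨φ⟩ : Nonempty (F →+* ℂ) := inferInstance
  simpa using hτ (hF φ).embedding

/-- The ring of integers of `F(s)`, inside the algebraic closure of `F`. -/
abbrev integersAdjoin (s : AlgebraicClosure F) : Subalgebra ℤ (AlgebraicClosure F) :=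
  integralClosure ℤ (AlgebraicClosure F) ⊓ (Algebra.adjoin F {s}).restrictScalars ℤ

theorem extIdeal_integersAdjoin_eq_span {a : Submodule ↥(integralClosure ℤ F) F} {τ : F}
    (hτ : τ ≠ 0) (ha : a * a = Submodule.span ↥(integralClosure ℤ F) {τ})
    {s : AlgebraicClosure F} (hs : s ^ 2 = algebraMap F (AlgebraicClosure F) (-τ)) :
    extIdeal (integersAdjoin s) a = Submodule.span ↥(integersAdjoin s) {s} := by
  have hs0 : s ≠ 0 := by
    rintro rfl
    rw [zero_pow two_ne_zero, eq_comm, map_eq_zero, neg_eq_zero] at hs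
    exact hτ hs
  have hsinv : s⁻¹ = algebraMap F (AlgebraicClosure F) (-τ)⁻¹ * s := by
    rw [map_inv₀, ← hs]
    field_simp
  have mem : ∀ t ∈ a, algebraMap F (AlgebraicClosure F) t * s⁻¹ ∈ integersAdjoin s := by
    intro t ht
    refine ⟨?_, ?_⟩
    · have htt : t * t ∈ a * a := Submodule.mul_mem_mul ht ht
      rw [ha] at htt
      obtain ⟨c, hc⟩ := Submodule.mem_span_singleton.1 htt
      have hc : (c : F) * τ = t * t := hc
      refine IsIntegral.of_pow (n := 2) two_pos ?_
      have : (algebraMap F (AlgebraicClosure F) t * s⁻¹) ^ 2 =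
          -algebraMap F (AlgebraicClosure F) c := by
        rw [mul_pow, inv_pow, hs, ← map_pow, pow_two, ← hc, ← map_inv₀, ← map_mul, ← map_neg]
        congr 1
        field_simp
      rw [this]
      exact (map_isIntegral_int (algebraMap F (AlgebraicClosure F)) c.2).neg
    · change _ ∈ Algebra.adjoin F {s}
      rw [hsinv]
      exact mul_mem (Subalgebra.algebraMap_mem _ _) (mul_mem (Subalgebra.algebraMap_mem _ _)
        (Algebra.self_mem_adjoin_singleton F s))
  apply le_antisymm
  · refine Submodule.span_le.2 ?_
    rintro _ ⟨t, ht, rfl⟩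
    refine Submodule.mem_span_singleton.2 ⟨⟨_, mem t ht⟩, ?_⟩
    change algebraMap F (AlgebraicClosure F) t * s⁻¹ * s = _
    rw [inv_mul_cancel_right₀ hs0]
  · rw [Submodule.span_singleton_le_iff_mem]
    have aux : ∀ t ∈ a * a, algebraMap F (AlgebraicClosure F) t * s⁻¹ ∈
        extIdeal (integersAdjoin s) a := by
      intro t ht
      induction ht using Submodule.mul_induction_on' with
      | mem_mul_mem p hp q hq =>
        have := Submodule.smul_mem (extIdeal (integersAdjoin s) a)
          (⟨_, mem p hp⟩ : ↥(integersAdjoin s)) (Submodule.subset_span ⟨q, hq, rfl⟩)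
        convert this using 1
        change _ = algebraMap F (AlgebraicClosure F) p * s⁻¹ * algebraMap F (AlgebraicClosure F) q
        rw [map_mul, mul_right_comm]
      | add p hp q hq hp' hq' =>
        rw [map_add, add_mul]
        exact add_mem hp' hq'
    have h1 := neg_mem (aux τ (ha ▸ Submodule.mem_span_singleton_self τ))
    convert h1 using 1
    rw [← neg_mul, ← map_neg, ← hs, pow_two, mul_inv_cancel_right₀ hs0]

theorem exists_zsmul_mem_integersAdjoin {s t : AlgebraicClosure F}
    (ht : t ∈ Algebra.adjoin F {s}) : ∃ n : ℤ, n ≠ 0 ∧ n • t ∈ integersAdjoin s := by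
  have halg : IsAlgebraic ℤ t := by
    have : Algebra.IsAlgebraic ℚ (AlgebraicClosure F) := Algebra.IsAlgebraic.trans ℚ F _
    exact (IsFractionRing.isAlgebraic_iff ℤ ℚ (AlgebraicClosure F)).2
      (Algebra.IsAlgebraic.isAlgebraic t)
  obtain ⟨n, hn, hint⟩ := halg.exists_integral_multiple
  exact ⟨n, hn, hint, zsmul_mem ht n⟩

theorem adjoin_integersAdjoin (s : AlgebraicClosure F) :
    Algebra.adjoin F (integersAdjoin s : Set (AlgebraicClosure F)) = Algebra.adjoin F {s} := by
  apply le_antisymm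
  · exact Algebra.adjoin_le fun t ht => ht.2
  · refine Algebra.adjoin_le (Set.singleton_subset_iff.2 ?_)
    obtain ⟨n, hn, h⟩ := exists_zsmul_mem_integersAdjoin (Algebra.self_mem_adjoin_singleton F s)
    have hn' : (n : F) ≠ 0 := Int.cast_ne_zero.2 hn
    have := Subalgebra.smul_mem _ (Algebra.subset_adjoin (R := F) h) (n : F)⁻¹
    rwa [← Int.cast_smul_eq_zsmul F, smul_smul, inv_mul_cancel₀ hn', one_smul] at this

theorem span_rat_integersAdjoin (s : AlgebraicClosure F) :
    Submodule.span ℚ (integersAdjoin s : Set (AlgebraicClosure F)) =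
      Subalgebra.toSubmodule ((Algebra.adjoin F {s}).restrictScalars ℚ) := by
  apply le_antisymm
  · exact Submodule.span_le.2 fun t ht => ht.2
  · intro t ht
    obtain ⟨n, hn, h⟩ := exists_zsmul_mem_integersAdjoin (F := F) ht
    have hn' : (n : ℚ) ≠ 0 := Int.cast_ne_zero.2 hn
    have := Submodule.smul_mem _ (n : ℚ)⁻¹ (Submodule.subset_span (R := ℚ) h)
    rwa [← Int.cast_smul_eq_zsmul ℚ, smul_smul, inv_mul_cancel₀ hn', one_smul] at this

theorem fg_integersAdjoin (s : AlgebraicClosure F) :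
    (Subalgebra.toSubmodule (integersAdjoin s)).FG := by
  have hs : IsIntegral F s := Algebra.IsIntegral.isIntegral s
  have : Module.Finite F (IntermediateField.adjoin F {s}) :=
    IntermediateField.adjoin.finiteDimensional hs
  have : NumberField (IntermediateField.adjoin F {s}) := NumberField.of_module_finite F _
  have hfin : Module.Finite ℤ (integralClosure ℤ (IntermediateField.adjoin F {s})) :=
    inferInstanceAs (Module.Finite ℤ (NumberField.RingOfIntegers (IntermediateField.adjoin F {s})))
  have hmap : integersAdjoin s = (integralClosure ℤ (IntermediateField.adjoin F {s})).map
      ((IntermediateField.adjoin F {s}).val.restrictScalars ℤ) := by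
    ext t
    constructor
    · rintro ⟨h1, h2⟩
      have h2 : t ∈ IntermediateField.adjoin F {s} :=
        IntermediateField.algebra_adjoin_le_adjoin F {s} h2
      refine ⟨⟨t, h2⟩, ?_, rfl⟩
      exact (isIntegral_algHom_iff ((IntermediateField.adjoin F {s}).val.restrictScalars ℤ)
        Subtype.val_injective).1 h1
    · rintro ⟨t, ht, rfl⟩
      refine ⟨IsIntegral.map ((IntermediateField.adjoin F {s}).val.restrictScalars ℤ) ht, ?_⟩
      have h2 := t.2
      rw [← IntermediateField.mem_toSubalgebra,
        IntermediateField.adjoin_simple_toSubalgebra_of_isAlgebraic hs.isAlgebraic] at h2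
      exact h2
  rw [hmap, Subalgebra.map_toSubmodule]
  exact Submodule.FG.map _ (Module.Finite.iff_fg.1 hfin)

/-- The ring of integers of `F(√-τ)`, for `τ` totally positive, as a CM order. -/
def CMOrder.ofTotPos (hF : TotReal F) {τ : F} (hτ : TotPos τ) {s : AlgebraicClosure F}
    (hs : s ^ 2 = algebraMap F (AlgebraicClosure F) (-τ)) : CMOrder (integralClosure ℤ F) where
  B := integersAdjoin s
  fg := fg_integersAdjoin s
  quadratic := by
    rw [adjoin_integersAdjoin]
    refine finrank_adjoin_sqrt hs ?_
    rintro ⟨r, hr⟩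
    obtain ⟨φ⟩ : Nonempty (F →+* ℂ) := inferInstance
    have h1 := hτ (hF φ).embedding
    have h2 := congrArg (hF φ).embedding hr
    rw [map_neg, map_mul] at h2
    nlinarith [mul_self_nonneg ((hF φ).embedding r)]
  imaginary := by
    refine isEmpty_ringHom_real hτ hs _ ?_
    rw [adjoin_integersAdjoin]
    exact Algebra.self_mem_adjoin_singleton F s
  full := by rw [adjoin_integersAdjoin, span_rat_integersAdjoin]
  proper x := by
    refine ⟨fun h => ?_, fun h => ⟨?_, Subalgebra.algebraMap_mem _ x⟩⟩
    · exact (isIntegral_algebraMap_iff (algebraMap F (AlgebraicClosure F)).injective).1 h.1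
    · exact map_isIntegral_int (algebraMap F (AlgebraicClosure F)) h

end Orders

theorem capitulation_in_CM_order_iff_narrow_two_torsion
    {F : Type*} [Field F] [NumberField F] (hF : TotReal F)
    (a : (Submodule ↥(integralClosure ℤ F) F)ˣ)
    (hnp : ¬ IsPrincipalIdl (integralClosure ℤ F)
      (a : Submodule ↥(integralClosure ℤ F) F)) :
    -- (1)  ∃ CM `O_F`-order `B` with `[a] ∈ ker (i_{B/O_F})`  ↔  `[a] ∈ C₂(F)`
    ((∃ C : CMOrder (integralClosure ℤ F),
        Capitulates C.B (a : Submodule ↥(integralClosure ℤ F) F)) ↔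
      (∃ τ : F, TotPos τ ∧
        ((a * a : (Submodule ↥(integralClosure ℤ F) F)ˣ) :
            Submodule ↥(integralClosure ℤ F) F)
          = Submodule.span ↥(integralClosure ℤ F) {τ})) ∧
    -- (2)  if `a² = τ O_F` with `τ` totally positive then `a` capitulates in `O_K`,
    --      `K = F(√−τ)`
    (∀ τ : F, TotPos τ →
      ((a * a : (Submodule ↥(integralClosure ℤ F) F)ˣ) :
          Submodule ↥(integralClosure ℤ F) F)
        = Submodule.span ↥(integralClosure ℤ F) {τ} →
      ∀ s : AlgebraicClosure F, s ^ 2 = algebraMap F (AlgebraicClosure F) (-τ) →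
      ∃ x : AlgebraicClosure F, x ≠ 0 ∧
        extIdeal (integralClosure ℤ (AlgebraicClosure F) ⊓
            (Algebra.adjoin F {s}).restrictScalars ℤ)
          (a : Submodule ↥(integralClosure ℤ F) F)
        = Submodule.span
            ↥(integralClosure ℤ (AlgebraicClosure F) ⊓
              (Algebra.adjoin F {s}).restrictScalars ℤ) {x}) ∧
    -- (3)  `𝓑 = ⨆ 𝓑_{[a]}`: every CM `O_F`-order with nontrivial kernel admits exactly
    --      one nontrivial class capitulating in it, and this class lies in `C₂(F)`
    (∀ C : CMOrder (integralClosure ℤ F), HasNontrivialKernel C →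
      (∃! c : Picard (integralClosure ℤ F), c ≠ 1 ∧
        c ∈ picCls (integralClosure ℤ F) ''
          {u : (Submodule ↥(integralClosure ℤ F) F)ˣ |
            Capitulates C.B (u : Submodule ↥(integralClosure ℤ F) F)}) ∧
      (∀ c : Picard (integralClosure ℤ F), c ≠ 1 →
        c ∈ picCls (integralClosure ℤ F) ''
          {u : (Submodule ↥(integralClosure ℤ F) F)ˣ |
            Capitulates C.B (u : Submodule ↥(integralClosure ℤ F) F)} →
        c ∈ picCls (integralClosure ℤ F) ''
          {u : (Submodule ↥(integralClosure ℤ F) F)ˣ | ∃ τ : F, TotPos τ ∧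
            ((u * u : (Submodule ↥(integralClosure ℤ F) F)ˣ) :
                Submodule ↥(integralClosure ℤ F) F)
              = Submodule.span ↥(integralClosure ℤ F) {τ}})) := by
  have hsq : ∀ τ : F, TotPos τ →
      ((a * a : (Submodule ↥(integralClosure ℤ F) F)ˣ) : Submodule ↥(integralClosure ℤ F) F)
        = Submodule.span ↥(integralClosure ℤ F) {τ} →
      ∀ s : AlgebraicClosure F, s ^ 2 = algebraMap F (AlgebraicClosure F) (-τ) →
      Capitulates (integersAdjoin s) (a : Submodule ↥(integralClosure ℤ F) F) := by
    intro τ hτ ha s hs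
    have hτ0 := hτ.ne_zero hF
    refine ⟨s, ?_, extIdeal_integersAdjoin_eq_span hτ0 ha hs⟩
    rintro rfl
    rw [zero_pow two_ne_zero, eq_comm, map_eq_zero, neg_eq_zero] at hs
    exact hτ0 hs
  refine ⟨⟨?_, ?_⟩, hsq, fun C hC => ⟨?_, ?_⟩⟩
  · rintro ⟨C, hC⟩
    obtain ⟨τ, -, hτ, h⟩ := hC.exists_totPos_sq hF
    exact ⟨τ, hτ, h⟩
  · rintro ⟨τ, hτ, h⟩
    obtain ⟨s, hs⟩ := IsAlgClosed.exists_pow_nat_eq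
      (algebraMap F (AlgebraicClosure F) (-τ)) two_pos
    exact ⟨CMOrder.ofTotPos hF hτ hs, hsq τ hτ h s hs⟩
  · obtain ⟨u, hu, hcap⟩ := hC
    have hu1 : picCls (integralClosure ℤ F) u ≠ 1 := fun h => hu (picCls_eq_one_iff.1 h)
    refine ⟨picCls _ u, ⟨hu1, u, hcap, rfl⟩, ?_⟩
    rintro _ ⟨hv1, v, hv, rfl⟩
    exact picCls_eq_of_capitulates hF hv hcap hv1 hu1
  · rintro _ - ⟨v, hv, rfl⟩
    obtain ⟨τ, -, hτ, h⟩ := Capitulates.exists_totPos_sq hF hv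
    exact ⟨v, ⟨τ, hτ, h⟩, rfl⟩

end
end
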